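/- arXiv:2412.14036 — 5 statements merged into one kernel-verified Lean document; each statement's English description precedes it below -/
import Mathlib

section
/- For all integers d ≥ 2 and k ≥ 0, the cardinality of B_{⌊d/2⌋+1, 2⌊d/2⌋+2+dk} equals ((2dk+4⌊d/2⌋+4)(2dk+4⌊d/2⌋)···(2dk+4)) / (⌊d/2⌋+1)!, where the numerator is the product of the ⌊d/2⌋+1 terms 2dk+4s for s = 1, 2, ..., ⌊d/2⌋+1. -/
/-- Colours for the chords of a diagram in the class `𝓑`. -/
inductive ChordColor : Type
  | red
  | blue
  | black
  deriving DecidableEq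

/-- Raw data of a coloured partial rooted chord diagram on the points `{0, …, m-1}`
(cyclically ordered): `mate x` is the other end of the chord on `x` (or `none` if `x` is bare),
`color x` is the colour of the chord on `x`, and `first x` records whether `x` is the
designated first end of a red or blue chord. -/
structure DiagramData (m : ℕ) where
  mate : Fin m → Option (Fin m)
  color : Fin m → ChordColor
  first : Fin m → Bool

namespace DiagramData

variable {m : ℕ}

/-- Position of `y` measured cyclically (counterclockwise) from `a`. -/
def rel (a y : Fin m) : ℕ := (y.val + m - a.val) % m

/-- `z` lies strictly inside the cyclic interval running from the first end `a`
to the other end `c`. -/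
def InsideCyc (a c z : Fin m) : Prop := 0 < rel a z ∧ rel a z < rel a c

instance (a c z : Fin m) : Decidable (InsideCyc a c z) := by
  unfold InsideCyc; infer_instance

/-- The point lying `s` steps cyclically before `x`. -/
def cycPred (x : Fin m) (s : ℕ) : Fin m :=
  ⟨(x.val + s * (m - 1)) % m, Nat.mod_lt _ x.pos⟩

/-- `x` is a bare point of `b` (a singleton part of the partition). -/
def IsBare (b : DiagramData m) (x : Fin m) : Prop := b.mate x = none

/-- `mate` describes a partial matching: parts of size one or two. -/
def IsMatching (b : DiagramData m) : Prop :=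
  (∀ x y, b.mate x = some y → b.mate y = some x) ∧ ∀ x, b.mate x ≠ some x

/-- No two chords cross (in the linear order on the points). -/
def Noncrossing (b : DiagramData m) : Prop :=
  ∀ x y u v, b.mate x = some y → b.mate u = some v → x < u → u < y → y < v → False

/-- Colours are attached to chords (both ends agree), and bare points carry the
default colour black. -/
def ColorOK (b : DiagramData m) : Prop :=
  (∀ x y, b.mate x = some y → b.color x = b.color y) ∧
    ∀ x, b.mate x = none → b.color x = ChordColor.black

/-- Exactly the red and blue chords have a designated first end, one per chord. -/
def FirstOK (b : DiagramData m) : Prop :=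
  (∀ x, b.first x = true → (b.mate x).isSome ∧ b.color x ≠ ChordColor.black) ∧
    ∀ x y, b.mate x = some y → b.color x ≠ ChordColor.black → b.first x = !b.first y

/-- Every point inside a red or blue chord lies on a black chord, and every black
chord lies inside some red or blue chord. -/
def InsideOK (b : DiagramData m) : Prop :=
  (∀ x y, b.mate x = some y → b.first x = true →
      ∀ z, InsideCyc x y z → (b.mate z).isSome ∧ b.color z = ChordColor.black) ∧
    ∀ z w, b.mate z = some w → b.color z = ChordColor.black →
      ∃ x y, b.mate x = some y ∧ b.first x = true ∧ InsideCyc x y z ∧ InsideCyc x y w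

/-- Membership in the set `𝓑_{n,m}` of the paper: a noncrossing coloured partial rooted
chord diagram with `n` chords on `m` points, black chords exactly filling the insides
of the red and blue chords. -/
def MemB (n : ℕ) (b : DiagramData m) : Prop :=
  b.IsMatching ∧ b.Noncrossing ∧ b.ColorOK ∧ b.FirstOK ∧ b.InsideOK ∧
    (Finset.univ.filter fun x : Fin m => (b.mate x).isSome).card = 2 * n

/-- Width of the red or blue chord with first end `x`: one plus the number of black
chords inside it. -/
def width (b : DiagramData m) (x : Fin m) : ℕ :=
  1 + (Finset.univ.filter fun z : Fin m =>
        ∃ w y, b.mate z = some w ∧ z < w ∧ b.color z = ChordColor.black ∧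
          b.mate x = some y ∧ InsideCyc x y z ∧ InsideCyc x y w).card

/-- Sum of the widths of the red/blue chords whose first ends precede `x`. -/
def prefixWidth (b : DiagramData m) (x : Fin m) : ℕ :=
  ∑ y ∈ Finset.univ.filter (fun y : Fin m => b.first y = true ∧ y < x), b.width y

/-- Membership in the set `𝓑_{n,m,c,e}` of the paper: an element of `𝓑_{n,m}` such that
for every first end `e_j` (in increasing order) with `w(e_1) + ⋯ + w(e_{j-1}) < e`, there
are fewer than `c` consecutive bare points immediately cyclically preceding `e_j`
(equivalently, one of the `c` points cyclically preceding `e_j` is not bare). -/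
def MemBFull (n c e : ℕ) (b : DiagramData m) : Prop :=
  b.MemB n ∧ ∀ x, b.first x = true → b.prefixWidth x < e →
    ∃ s, 1 ≤ s ∧ s ≤ c ∧ ¬ b.IsBare (cycPred x s)

end DiagramData

/-- Number of `±1` walks of length `L` with total displacement `x`. -/
def signWalkCount : ℕ → ℤ → ℕ
  | 0, x => if x = 0 then 1 else 0
  | L + 1, x => signWalkCount L (x + 1) + signWalkCount L (x - 1)

theorem signWalkCount_neg (L : ℕ) (x : ℤ) : signWalkCount L (-x) = signWalkCount L x := by
  induction L generalizing x with
  | zero => simp [signWalkCount]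
  | succ L ih =>
    simp only [signWalkCount]
    rw [← ih (x + 1), ← ih (x - 1), add_comm]
    ring_nf

theorem signWalkCount_eq_zero (L : ℕ) (x : ℤ) (h : (L : ℤ) < |x|) : signWalkCount L x = 0 := by
  induction L generalizing x with
  | zero =>
    have : x ≠ 0 := by rintro rfl; simp at h
    simp [signWalkCount, this]
  | succ L ih =>
    simp only [signWalkCount]
    rw [ih, ih] <;> grind

theorem signWalkCount_eq_choose (L j : ℕ) : signWalkCount L (2 * j - L) = L.choose j := by
  induction L generalizing j with
  | zero => cases j <;> simp [signWalkCount]; omega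
  | succ L ih =>
    simp only [signWalkCount]
    rcases j with _ | j
    · rw [signWalkCount_eq_zero L (2 * ((0 : ℕ) : ℤ) - ((L + 1 : ℕ) : ℤ) - 1)
        (by rw [abs_of_neg] <;> push_cast <;> omega)]
      have := ih 0
      rw [Nat.choose_zero_right] at this ⊢
      rw [add_zero]
      convert this using 2
      push_cast
      ring
    · rw [Nat.choose_succ_succ, ← ih j, ← ih (j + 1), add_comm]
      congr 2 <;> push_cast <;> ring

theorem signWalkCount_odd (i : ℕ) (x : ℤ) (h : Odd (i + x)) : signWalkCount i x = 0 := by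
  induction i generalizing x with
  | zero =>
    have : x ≠ 0 := by rintro rfl; simp at h
    simp [signWalkCount, this]
  | succ L ih =>
    simp only [signWalkCount]
    rw [ih, ih] <;> grind

theorem sum_signWalkCount (n : ℕ) :
    ∑ h ∈ Finset.Icc (-(n : ℤ)) n, signWalkCount (2 * n) (2 * h) = 4 ^ n := by
  have e : (4 : ℕ) ^ n = 2 ^ (2 * n) := by rw [pow_mul]; norm_num
  rw [e, ← Nat.sum_range_choose]
  symm
  refine Finset.sum_bij (fun j _ => (j : ℤ) - n) ?_ ?_ ?_ ?_
  · intro j hj; simp at hj ⊢; omega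
  · intro a _ b _ h; simpa using h
  · intro h hh
    simp only [Finset.mem_Icc] at hh
    exact ⟨(h + n).toNat, by simp; omega, by omega⟩
  · intro j _
    rw [← signWalkCount_eq_choose]
    congr 1
    push_cast
    ring

/-- Number of walks of length `L` from `a` to `b` having `±1` steps and exactly `p` flat steps,
all of them at height `0`. -/
def walkCount : ℕ → ℕ → ℤ → ℤ → ℕ
  | 0, p, a, b => if p = 0 ∧ a = b then 1 else 0
  | L + 1, 0, a, b => walkCount L 0 (a + 1) b + walkCount L 0 (a - 1) b
  | L + 1, p + 1, a, b => walkCount L (p + 1) (a + 1) b + walkCount L (p + 1) (a - 1) b +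
      if a = 0 then walkCount L p 0 b else 0

theorem walkCount_of_lt (L p : ℕ) (a b : ℤ) (h : L < p) : walkCount L p a b = 0 := by
  induction L generalizing p a with
  | zero => simp [walkCount]; omega
  | succ L ih =>
    rcases p with _ | p
    · omega
    · simp [walkCount, ih (p + 1) _ (by omega), ih p _ (by omega)]

theorem walkCount_no_flat (L : ℕ) (a b : ℤ) : walkCount L 0 a b = signWalkCount L (a - b) := by
  induction L generalizing a with
  | zero => simp [walkCount, signWalkCount, sub_eq_zero]
  | succ L ih =>
    simp only [walkCount, signWalkCount, ih]
    congr 2 <;> ring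

theorem walkCount_convolution (p j : ℕ) (a : ℤ) :
    walkCount (p + 1 + j) (p + 1) a 0 =
      ∑ x ∈ Finset.HasAntidiagonal.antidiagonal j,
        signWalkCount x.1 a * walkCount (p + x.2) p 0 0 := by
  induction j generalizing a with
  | zero =>
    simp only [add_zero, walkCount, walkCount_of_lt p (p + 1) _ _ (Nat.lt_succ_self p)]
    simp [signWalkCount]
  | succ j ih =>
    rw [Finset.Nat.antidiagonal_succ, Finset.sum_cons, Finset.sum_map,
      show p + 1 + (j + 1) = (p + 1 + j) + 1 by ring]
    simp only [walkCount, ih, signWalkCount]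
    simp only [Function.Embedding.prodMap, Function.Embedding.coeFn_mk, Prod.map, signWalkCount,
      Function.Embedding.refl_apply, add_mul, Finset.sum_add_distrib, Nat.succ_eq_add_one]
    rw [show p + 1 + j = p + (j + 1) by ring]
    split_ifs <;> simp [add_comm]

/-- Generating function of the balanced `±1` walks by length. -/
noncomputable def balancedSeries : PowerSeries ℝ := PowerSeries.mk fun j => (signWalkCount j 0 : ℝ)

theorem coeff_balancedSeries_pow (p j : ℕ) :
    PowerSeries.coeff j (balancedSeries ^ (p + 1)) = (walkCount (p + j) p 0 0 : ℝ) := by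
  induction p generalizing j with
  | zero => simp [balancedSeries, walkCount_no_flat]
  | succ p ih =>
    rw [walkCount_convolution, pow_succ', PowerSeries.coeff_mul]
    push_cast
    refine Finset.sum_congr rfl fun x _ => ?_
    rw [ih]
    simp [balancedSeries]

theorem signWalkCount_even (i : ℕ) : signWalkCount (2 * i) 0 = i.centralBinom := by
  rw [Nat.centralBinom, ← signWalkCount_eq_choose]
  simp

theorem signWalkCount_recurrence (k : ℕ) :
    (k + 2) * signWalkCount (k + 2) 0 = 4 * (k + 1) * signWalkCount k 0 := by
  rcases Nat.even_or_odd' k with ⟨i, rfl | rfl⟩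
  · rw [show 2 * i + 2 = 2 * (i + 1) by ring, signWalkCount_even, signWalkCount_even]
    have := Nat.succ_mul_centralBinom_succ i
    linear_combination 2 * this
  · rw [signWalkCount_odd, signWalkCount_odd]
    · simp
    · exact ⟨i, by push_cast; ring⟩
    · exact ⟨i + 1, by push_cast; ring⟩

open PowerSeries in
theorem derivative_balancedSeries :
    derivative ℝ balancedSeries =
      C 4 * (X * (X * derivative ℝ balancedSeries)) + C 4 * (X * balancedSeries) := by
  ext k
  rw [map_add, coeff_C_mul, coeff_C_mul, coeff_derivative]
  rcases k with _ | k
  · rw [coeff_zero_X_mul, coeff_zero_X_mul]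
    simp [balancedSeries, signWalkCount]
  · have h := signWalkCount_recurrence k
    have h' : ((k : ℝ) + 2) * signWalkCount (k + 2) 0 = 4 * (k + 1) * signWalkCount k 0 := by
      exact_mod_cast h
    rw [coeff_succ_X_mul, coeff_succ_X_mul]
    rcases k with _ | k
    · rw [coeff_zero_X_mul]
      simp [balancedSeries] at h' ⊢
      linear_combination h'
    · rw [coeff_succ_X_mul, coeff_derivative]
      simp only [balancedSeries, coeff_mk]
      push_cast at h' ⊢
      linear_combination h'

open PowerSeries in
theorem derivative_balancedSeries_pow (q : ℕ) :
    derivative ℝ (balancedSeries ^ q) =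
      C 4 * (X * (X * derivative ℝ (balancedSeries ^ q))) +
        C (4 * (q : ℝ)) * (X * balancedSeries ^ q) := by
  rcases q with _ | q
  · simp
  · rw [derivative_pow, map_mul, map_natCast, pow_succ]
    simp only [Nat.add_sub_cancel]
    linear_combination ((q + 1 : ℕ) : PowerSeries ℝ) * balancedSeries ^ q *
      derivative_balancedSeries

open PowerSeries in
theorem coeff_balancedSeries_pow_recurrence (q k : ℕ) :
    ((k : ℝ) + 2) * coeff (k + 2) (balancedSeries ^ q) =
      (4 * k + 4 * q) * coeff k (balancedSeries ^ q) := by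
  have h := congrArg (coeff (k + 1)) (derivative_balancedSeries_pow q)
  rw [map_add, coeff_C_mul, coeff_C_mul, coeff_derivative, coeff_succ_X_mul,
    coeff_succ_X_mul] at h
  rcases k with _ | k
  · rw [coeff_zero_X_mul] at h
    push_cast at h ⊢
    linear_combination h
  · rw [coeff_succ_X_mul, coeff_derivative] at h
    push_cast at h ⊢
    linear_combination h

theorem factorial_mul_coeff (q n : ℕ) :
    (n.factorial : ℝ) * PowerSeries.coeff (2 * n) (balancedSeries ^ q) =
      ∏ s ∈ Finset.range n, (2 * (q : ℝ) + 4 * s) := by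
  induction n with
  | zero =>
    simp [balancedSeries, signWalkCount]
  | succ n ih =>
    rw [Finset.prod_range_succ, ← ih, Nat.factorial_succ]
    have := coeff_balancedSeries_pow_recurrence q (2 * n)
    push_cast at this ⊢
    rw [show 2 * (n + 1) = 2 * n + 2 by ring]
    linear_combination (n.factorial : ℝ) / 2 * this

/-- Admissible steps of a height function: up, down, or flat at height `0`. -/
def IsHeightStep (u v : ℤ) : Prop := v = u + 1 ∨ v = u - 1 ∨ (u = 0 ∧ v = 0)

/-- Height functions of linear walks of length `L` from `a` to `b` with `p` flat steps. -/
def linearWalks (L p : ℕ) (a b : ℤ) : Set (Fin (L + 1) → ℤ) :=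
  {f | f 0 = a ∧ f (Fin.last L) = b ∧ (∀ i : Fin L, IsHeightStep (f i.castSucc) (f i.succ)) ∧
    (Finset.univ.filter fun i : Fin L => f i.succ = f i.castSucc).card = p}

theorem cons_mem_linearWalks {L p : ℕ} {a a' b : ℤ} {f : Fin (L + 1) → ℤ} :
    (Fin.cons a' f : Fin (L + 2) → ℤ) ∈ linearWalks (L + 1) p a b ↔
      a' = a ∧ ((p ≠ 0 ∧ a = 0 ∧ f ∈ linearWalks L (p - 1) 0 b) ∨
        f ∈ linearWalks L p (a + 1) b ∨ f ∈ linearWalks L p (a - 1) b) := by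
  simp only [linearWalks, Set.mem_ofPred_eq, Fin.cons_zero, ← Fin.succ_last, Fin.cons_succ,
    Fin.forall_fin_succ, Fin.castSucc_zero, ← Fin.succ_castSucc, Fin.card_filter_univ_succ]
  simp only [IsHeightStep]
  constructor
  · rintro ⟨rfl, h2, ⟨h3, h4⟩, h5⟩
    refine ⟨rfl, ?_⟩
    split_ifs at h5 with h6 <;> grind
  · rintro ⟨rfl, h⟩
    rcases h with ⟨hp, rfl, h1, h2, h3, h4⟩ | ⟨h1, h2, h3, h4⟩ | ⟨h1, h2, h3, h4⟩
    · simp_all; omega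
    · simp_all
    · simp_all

theorem encard_consImage {L : ℕ} (a : ℤ) (S : Set (Fin (L + 1) → ℤ)) :
    ((fun f => (Fin.cons a f : Fin (L + 2) → ℤ)) '' S).encard = S.encard :=
  Function.Injective.encard_image (Fin.cons_right_injective (α := fun _ => ℤ) a) S

theorem disjoint_linearWalks {L p q : ℕ} {a a' b b' : ℤ} (h : a ≠ a') :
    Disjoint (linearWalks L p a b) (linearWalks L q a' b') :=
  Set.disjoint_left.2 fun _ hf hf' => h (hf.1.symm.trans hf'.1)

theorem encard_linearWalks (L p : ℕ) (a b : ℤ) :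
    (linearWalks L p a b).encard = walkCount L p a b := by
  induction L generalizing p a with
  | zero =>
    simp only [walkCount]
    split_ifs with h
    · obtain ⟨rfl, rfl⟩ := h
      have : linearWalks 0 0 a a = {fun _ => a} := by
        ext f
        simp only [linearWalks, Set.mem_ofPred_eq, Set.mem_singleton_iff]
        constructor
        · rintro ⟨h, -⟩
          ext i
          rw [Subsingleton.elim (α := Fin 1) i 0, h]
        · rintro rfl
          simp
      simp [this]
    · have : linearWalks 0 p a b = ∅ := by
        ext f
        simp [linearWalks]
        rintro rfl rfl rfl
        exact h ⟨rfl, rfl⟩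
      simp [this]
  | succ L ih =>
    have key : linearWalks (L + 1) p a b = (fun f => (Fin.cons a f : Fin (L + 2) → ℤ)) ''
        ((linearWalks L p (a + 1) b ∪ linearWalks L p (a - 1) b) ∪
          {f | p ≠ 0 ∧ a = 0 ∧ f ∈ linearWalks L (p - 1) 0 b}) := by
      ext f
      rw [← Fin.cons_self_tail f, cons_mem_linearWalks]
      simp only [Set.mem_image, Set.mem_union, Set.mem_ofPred_eq, Fin.cons_inj]
      grind
    have d1 : Disjoint (linearWalks L p (a + 1) b) (linearWalks L p (a - 1) b) :=
      disjoint_linearWalks (by omega)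
    have d2 : Disjoint (linearWalks L p (a + 1) b ∪ linearWalks L p (a - 1) b)
        {f | p ≠ 0 ∧ a = 0 ∧ f ∈ linearWalks L (p - 1) 0 b} := by
      rw [Set.disjoint_left]
      rintro f (hf | hf) ⟨-, h0, hf'⟩ <;> have := hf.1.symm.trans hf'.1 <;> omega
    rw [key, encard_consImage, Set.encard_union_eq d2, Set.encard_union_eq d1, ih, ih]
    rcases p with _ | p
    · simp [walkCount]
    · by_cases h : a = 0
      · simp [walkCount, h, ih]
      · simp [walkCount, h]

theorem encard_linearWalks_hitting_zero (L : ℕ) (a b : ℤ) :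
    {f ∈ linearWalks L 0 a b | ∃ i, f i = 0}.encard = signWalkCount L (|a| + |b|) := by
  by_cases ha : a = 0
  · subst ha
    have : {f ∈ linearWalks L 0 0 b | ∃ i, f i = 0} = linearWalks L 0 0 b := by
      ext f
      exact ⟨fun h => h.1, fun h => ⟨h, 0, h.1⟩⟩
    rw [this, encard_linearWalks, walkCount_no_flat, zero_sub, abs_zero, zero_add]
    rcases abs_choice b with h | h <;> rw [h]
    rw [signWalkCount_neg]
  induction L generalizing a with
  | zero =>
    have h1 : ¬ (|a| + |b| = 0) := by
      have := abs_pos.2 ha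
      have := abs_nonneg b
      omega
    have : {f ∈ linearWalks 0 0 a b | ∃ i, f i = 0} = ∅ := by
      ext f
      simp only [linearWalks, Set.mem_ofPred_eq, Set.mem_empty_iff_false, iff_false]
      rintro ⟨⟨h, -⟩, i, hi⟩
      rw [Subsingleton.elim (α := Fin 1) i 0] at hi
      exact ha (h.symm.trans hi)
    rw [this, Set.encard_empty]
    simp [signWalkCount, h1]
  | succ L ih =>
    have ih' (c : ℤ) : {f ∈ linearWalks L 0 c b | ∃ i, f i = 0}.encard =
        signWalkCount L (|c| + |b|) := by
      by_cases hc : c = 0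
      · subst hc
        have : {f ∈ linearWalks L 0 0 b | ∃ i, f i = 0} = linearWalks L 0 0 b := by
          ext f
          exact ⟨fun h => h.1, fun h => ⟨h, 0, h.1⟩⟩
        rw [this, encard_linearWalks, walkCount_no_flat, zero_sub, abs_zero, zero_add]
        rcases abs_choice b with h | h <;> rw [h]
        rw [signWalkCount_neg]
      · exact ih c hc
    have key : {f ∈ linearWalks (L + 1) 0 a b | ∃ i, f i = 0} =
        (fun f => (Fin.cons a f : Fin (L + 2) → ℤ)) ''
        ({f ∈ linearWalks L 0 (a + 1) b | ∃ i, f i = 0} ∪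
          {f ∈ linearWalks L 0 (a - 1) b | ∃ i, f i = 0}) := by
      ext f
      rw [← Fin.cons_self_tail f, Set.mem_ofPred_eq, cons_mem_linearWalks]
      have hex : (∃ i, (Fin.cons (f 0) (Fin.tail f) : Fin (L + 2) → ℤ) i = 0) ↔
          f 0 = 0 ∨ ∃ i, Fin.tail f i = 0 := by
        rw [Fin.exists_fin_succ, Fin.cons_zero]
        simp only [Fin.cons_succ]
      rw [hex]
      simp only [Set.mem_image, Set.mem_union, Set.mem_ofPred_eq, Fin.cons_inj]
      constructor
      · rintro ⟨⟨rfl, h⟩, h'⟩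
        exact ⟨Fin.tail f, by tauto, rfl, rfl⟩
      · rintro ⟨g, h, rfl, rfl⟩
        tauto
    have d : Disjoint {f ∈ linearWalks L 0 (a + 1) b | ∃ i, f i = 0}
        {f ∈ linearWalks L 0 (a - 1) b | ∃ i, f i = 0} :=
      (disjoint_linearWalks (by omega)).mono (Set.sep_subset _ _) (Set.sep_subset _ _)
    rw [key, encard_consImage, Set.encard_union_eq d, ih', ih', signWalkCount]
    rcases lt_or_gt_of_ne ha with h | h
    · rw [abs_of_neg h, abs_of_nonpos (by omega : a + 1 ≤ 0), abs_of_neg (by omega : a - 1 < 0),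
        add_comm]
      push_cast
      congr 3 <;> ring
    · rw [abs_of_pos h, abs_of_pos (by omega : 0 < a + 1), abs_of_nonneg (by omega : 0 ≤ a - 1)]
      push_cast
      congr 3 <;> ring

/-- The cyclic successor of a point. -/
def cycNext {m : ℕ} (x : Fin m) : Fin m := ⟨(x.val + 1) % m, Nat.mod_lt _ x.pos⟩

/-- Cyclic height functions on `m` points with `p` flat steps which reach height `0`. -/
def cyclicWalks (m p : ℕ) : Set (Fin m → ℤ) :=
  {H | (∀ i, IsHeightStep (H i) (H (cycNext i))) ∧ (∃ i, H i = 0) ∧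
    (Finset.univ.filter fun i => H (cycNext i) = H i).card = p}

theorem cycNext_castSucc {L : ℕ} (i : Fin L) : cycNext i.castSucc = i.succ := by
  ext
  simp [cycNext, Nat.mod_eq_of_lt]

theorem cycNext_last (L : ℕ) : cycNext (Fin.last L) = 0 := by
  ext
  simp [cycNext]

theorem mem_cyclicWalks_succ {L p : ℕ} {H : Fin (L + 1) → ℤ} :
    H ∈ cyclicWalks (L + 1) p ↔ (∀ i : Fin L, IsHeightStep (H i.castSucc) (H i.succ)) ∧
      IsHeightStep (H (Fin.last L)) (H 0) ∧ (∃ i, H i = 0) ∧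
      (Finset.univ.filter fun i : Fin L => H i.succ = H i.castSucc).card +
        (if H 0 = H (Fin.last L) then 1 else 0) = p := by
  simp only [cyclicWalks, Set.mem_ofPred_eq, Finset.card_filter, Fin.sum_univ_castSucc,
    Fin.forall_fin_succ', cycNext_castSucc, cycNext_last, and_assoc]

theorem cyclicWalks_flat_last (L p : ℕ) :
    {H ∈ cyclicWalks (L + 1) (p + 1) | H (cycNext (Fin.last L)) = H (Fin.last L)} =
      linearWalks L p 0 0 := by
  ext H
  simp only [Set.mem_ofPred_eq, mem_cyclicWalks_succ, cycNext_last, linearWalks, IsHeightStep]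
  constructor
  · rintro ⟨⟨h1, h2, h3, h4⟩, h5⟩
    rw [if_pos h5] at h4
    refine ⟨by omega, by omega, h1, by omega⟩
  · rintro ⟨h1, h2, h3, h4⟩
    refine ⟨⟨h3, by omega, ⟨0, h1⟩, ?_⟩, by omega⟩
    rw [if_pos (by omega), h4]

theorem cyclicWalks_no_flat (L : ℕ) (a : ℤ) :
    {H ∈ cyclicWalks (L + 1) 0 | H 0 = a} =
      {H ∈ linearWalks L 0 a (a + 1) | ∃ i, H i = 0} ∪
        {H ∈ linearWalks L 0 a (a - 1) | ∃ i, H i = 0} := by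
  ext H
  simp only [Set.mem_ofPred_eq, mem_cyclicWalks_succ, linearWalks, IsHeightStep, Set.mem_union]
  constructor
  · rintro ⟨⟨h1, h2, h3, h4⟩, h5⟩
    split_ifs at h4
    grind
  · rintro (⟨⟨h1, h2, h3, h4⟩, h5⟩ | ⟨⟨h1, h2, h3, h4⟩, h5⟩)
    · refine ⟨⟨h3, by omega, h5, ?_⟩, h1⟩
      rw [if_neg (by omega), h4]
    · refine ⟨⟨h3, by omega, h5, ?_⟩, h1⟩
      rw [if_neg (by omega), h4]

theorem encard_cyclicWalks_no_flat_fiber (L : ℕ) (a : ℤ) :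
    {H ∈ cyclicWalks (L + 1) 0 | H 0 = a}.encard = signWalkCount (L + 1) (2 * a) := by
  have d : Disjoint {H ∈ linearWalks L 0 a (a + 1) | ∃ i, H i = 0}
      {H ∈ linearWalks L 0 a (a - 1) | ∃ i, H i = 0} := by
    rw [Set.disjoint_left]
    rintro f ⟨hf, -⟩ ⟨hf', -⟩
    have := hf.2.1.symm.trans hf'.2.1
    omega
  rw [cyclicWalks_no_flat, Set.encard_union_eq d, encard_linearWalks_hitting_zero,
    encard_linearWalks_hitting_zero, signWalkCount]
  rcases lt_trichotomy a 0 with h | rfl | h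
  · rw [abs_of_neg h, abs_of_nonpos (by omega : a + 1 ≤ 0), abs_of_neg (by omega : a - 1 < 0),
      ← signWalkCount_neg L (2 * a + 1), ← signWalkCount_neg L (2 * a - 1)]
    push_cast
    congr 3 <;> ring
  · simp [← signWalkCount_neg L 1]
  · rw [abs_of_pos h, abs_of_pos (by omega : 0 < a + 1), abs_of_nonneg (by omega : 0 ≤ a - 1)]
    push_cast
    congr 3 <;> ring

theorem encard_cyclicWalks_zero (n : ℕ) (hn : 0 < n) :
    (cyclicWalks (2 * n) 0).encard = (4 ^ n : ℕ) := by
  obtain ⟨L, hL⟩ : ∃ L, 2 * n = L + 1 := ⟨2 * n - 1, by omega⟩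
  rw [hL]
  have key : cyclicWalks (L + 1) 0 = ⋃ a ∈ Finset.Icc (-(n : ℤ)) n,
      {H ∈ cyclicWalks (L + 1) 0 | H 0 = a} := by
    ext H
    simp only [Set.mem_iUnion, Set.mem_ofPred_eq, exists_prop, Finset.mem_Icc]
    constructor
    · intro hH
      refine ⟨H 0, ?_, hH, rfl⟩
      by_contra hlt
      have h0 : {H' ∈ cyclicWalks (L + 1) 0 | H' 0 = H 0}.encard = 0 := by
        rw [encard_cyclicWalks_no_flat_fiber, signWalkCount_eq_zero]
        · rfl
        · rw [lt_abs]; omega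
      rw [Set.encard_eq_zero] at h0
      have : H ∈ {H' ∈ cyclicWalks (L + 1) 0 | H' 0 = H 0} := ⟨hH, rfl⟩
      rw [h0] at this
      exact this
    · rintro ⟨a, -, h, -⟩
      exact h
  rw [key, ← sum_signWalkCount, hL]
  have := Set.Finite.encard_biUnion (Finset.Icc (-(n : ℤ)) n).finite_toSet
    (s := fun a => {H ∈ cyclicWalks (L + 1) 0 | H 0 = a}) (by
      intro a _ b _ hab
      exact Set.disjoint_left.2 fun H h h' => hab (h.2.symm.trans h'.2))
  simp only [Finset.mem_coe] at this
  rw [this]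
  refine (finsum_mem_coe_finset _ (Finset.Icc (-(n : ℤ)) n)).trans ?_
  push_cast
  exact Finset.sum_congr rfl fun a _ => encard_cyclicWalks_no_flat_fiber L a

theorem cycNext_val {m : ℕ} (x : Fin m) :
    (cycNext x).val = if x.val + 1 = m then 0 else x.val + 1 := by
  have := x.isLt
  simp only [cycNext]
  split_ifs with h
  · rw [h, Nat.mod_self]
  · exact Nat.mod_eq_of_lt (by omega)

theorem cycNext_injective {m : ℕ} : Function.Injective (cycNext (m := m)) := by
  intro x y h
  have h' := congrArg Fin.val h
  rw [cycNext_val, cycNext_val] at h'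
  ext
  have := x.isLt
  have := y.isLt
  split_ifs at h' <;> omega

theorem comp_cycNext_mem {m p : ℕ} {H : Fin m → ℤ} :
    H ∘ cycNext ∈ cyclicWalks m p ↔ H ∈ cyclicWalks m p := by
  have hb : Function.Bijective (cycNext (m := m)) :=
    Finite.injective_iff_bijective.1 cycNext_injective
  simp only [cyclicWalks, Set.mem_ofPred_eq, Function.comp_apply]
  rw [← hb.surjective.forall (p := fun i => IsHeightStep (H i) (H (cycNext i))),
    ← hb.surjective.exists (p := fun i => H i = 0)]
  have : (Finset.univ.filter fun i => H (cycNext (cycNext i)) = H (cycNext i)).card =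
      (Finset.univ.filter fun i => H (cycNext i) = H i).card :=
    Finset.card_bijective _ hb (by simp)
  rw [this]

theorem encard_flat_cycNext {m p : ℕ} (i : Fin m) :
    {H ∈ cyclicWalks m p | H (cycNext (cycNext i)) = H (cycNext i)}.encard =
      {H ∈ cyclicWalks m p | H (cycNext i) = H i}.encard := by
  have hb : Function.Bijective (cycNext (m := m)) :=
    Finite.injective_iff_bijective.1 cycNext_injective
  have hinj : Function.Injective fun H : Fin m → ℤ => H ∘ cycNext :=
    hb.surjective.injective_comp_right
  rw [← hinj.encard_image]
  congr 1
  ext H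
  constructor
  · rintro ⟨K, ⟨hK, hK'⟩, rfl⟩
    exact ⟨comp_cycNext_mem.2 hK, hK'⟩
  · rintro ⟨hH, hH'⟩
    obtain ⟨K, rfl⟩ : ∃ K : Fin m → ℤ, K ∘ cycNext = H :=
      hb.injective.surjective_comp_right H
    exact ⟨K, ⟨comp_cycNext_mem.1 hH, hH'⟩, rfl⟩

theorem encard_flat_at (L p : ℕ) (i : Fin (L + 1)) :
    {H ∈ cyclicWalks (L + 1) (p + 1) | H (cycNext i) = H i}.encard = walkCount L p 0 0 := by
  induction i using Fin.reverseInduction with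
  | last => rw [cyclicWalks_flat_last, encard_linearWalks]
  | cast i ih => rw [← encard_flat_cycNext, cycNext_castSucc, ih]

theorem finite_cyclicWalks_flat (L p : ℕ) : (cyclicWalks (L + 1) (p + 1)).Finite := by
  refine (Set.finite_iUnion fun i : Fin (L + 1) => Set.finite_of_encard_eq_coe
    (encard_flat_at L p i)).subset ?_
  intro H hH
  obtain ⟨i, hi⟩ : (Finset.univ.filter fun i => H (cycNext i) = H i).Nonempty := by
    rw [← Finset.card_pos, hH.2.2]
    omega
  exact Set.mem_iUnion.2 ⟨i, hH, by simpa using hi⟩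

theorem mul_ncard_cyclicWalks (L p : ℕ) :
    (p + 1) * (cyclicWalks (L + 1) (p + 1)).ncard = (L + 1) * walkCount L p 0 0 := by
  classical
  have hf := finite_cyclicWalks_flat L p
  have h := Finset.sum_card_bipartiteAbove_eq_sum_card_bipartiteBelow
    (s := hf.toFinset) (t := (Finset.univ : Finset (Fin (L + 1))))
    (fun H i => H (cycNext i) = H i)
  have habove : ∀ H ∈ hf.toFinset, (Finset.bipartiteAbove
      (fun (H : Fin (L + 1) → ℤ) i => H (cycNext i) = H i) Finset.univ H).card = p + 1 := by
    intro H hH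
    convert (hf.mem_toFinset.1 hH).2.2
    simp [Finset.bipartiteAbove]
  have hbelow : ∀ i ∈ (Finset.univ : Finset (Fin (L + 1))), (Finset.bipartiteBelow
      (fun H i => H (cycNext i) = H i) hf.toFinset i).card = walkCount L p 0 0 := by
    intro i _
    have h1 := encard_flat_at L p i
    have h2 : (Finset.bipartiteBelow (fun H i => H (cycNext i) = H i) hf.toFinset i :
        Set (Fin (L + 1) → ℤ)) = {H ∈ cyclicWalks (L + 1) (p + 1) | H (cycNext i) = H i} := by
      ext H
      simp [Finset.bipartiteBelow]
    rw [← h2, Set.encard_coe_eq_coe_finsetCard] at h1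
    exact_mod_cast h1
  rw [Finset.sum_const_nat habove, Finset.sum_const_nat hbelow,
    ← Set.ncard_eq_toFinset_card _ hf] at h
  simpa [mul_comm] using h

theorem factorial_mul_ncard_cyclicWalks (n p : ℕ) (hn : 0 < n) :
    (n.factorial : ℝ) * (cyclicWalks (2 * n + p) p).ncard =
      ∏ s ∈ Finset.range n, (2 * (p : ℝ) + 4 * (s + 1)) := by
  rcases p with _ | p
  · have h : (cyclicWalks (2 * n) 0).ncard = 4 ^ n := by
      rw [Set.ncard, encard_cyclicWalks_zero n hn]
      rfl
    rw [add_zero, h]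
    clear h hn
    induction n with
    | zero => simp
    | succ n ih =>
      rw [Finset.prod_range_succ, ← ih, Nat.factorial_succ]
      push_cast
      ring
  · have h1 := mul_ncard_cyclicWalks (2 * n + p) p
    have h2 := factorial_mul_coeff (p + 1) n
    rw [coeff_balancedSeries_pow, add_comm p] at h2
    have h1' : ((p : ℝ) + 1) * (cyclicWalks (2 * n + p + 1) (p + 1)).ncard =
      (2 * n + p + 1) * walkCount (2 * n + p) p 0 0 := by exact_mod_cast h1
    have h3 := Finset.prod_range_succ (fun s : ℕ => 2 * ((p + 1 : ℕ) : ℝ) + 4 * s) n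
    rw [Finset.prod_range_succ'] at h3
    have hp : (0 : ℝ) < p + 1 := by positivity
    rw [← h2] at h3
    push_cast at h3 ⊢
    refine mul_right_cancel₀ hp.ne' ?_
    rw [show 2 * n + (p + 1) = 2 * n + p + 1 by ring]
    linear_combination (n.factorial : ℝ) * h1' - h3 / 2

namespace DiagramData

variable {m : ℕ}

theorem rel_eq (x y : Fin m) :
    rel x y = if x.val ≤ y.val then y.val - x.val else y.val + m - x.val := by
  have := x.isLt
  have := y.isLt
  unfold rel
  split_ifs with h
  · rw [show y.val + m - x.val = y.val - x.val + m by omega, Nat.add_mod_right]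
    exact Nat.mod_eq_of_lt (by omega)
  · exact Nat.mod_eq_of_lt (by omega)

theorem rel_lt (x y : Fin m) : rel x y < m := Nat.mod_lt _ x.pos

theorem rel_self (x : Fin m) : rel x x = 0 := by
  rw [rel_eq]
  simp

theorem rel_trans (x y z : Fin m) :
    rel x y + rel y z = rel x z ∨ rel x y + rel y z = rel x z + m := by
  have := x.isLt
  have := y.isLt
  have := z.isLt
  rw [rel_eq, rel_eq, rel_eq]
  split_ifs <;> omega

theorem rel_right_injective {x y z : Fin m} (h : rel x y = rel x z) : y = z := by
  have := x.isLt
  have := y.isLt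
  have := z.isLt
  rw [rel_eq, rel_eq] at h
  ext
  split_ifs at h <;> omega

theorem rel_cycNext (x y : Fin m) :
    rel x (cycNext y) = if rel x y + 1 = m then 0 else rel x y + 1 := by
  have := x.isLt
  have := y.isLt
  rw [rel_eq, rel_eq, cycNext_val]
  split_ifs <;> omega

theorem exists_rel_right (x : Fin m) {t : ℕ} (ht : t < m) : ∃ y, rel x y = t := by
  have := x.isLt
  by_cases h : x.val + t < m
  · refine ⟨⟨x.val + t, h⟩, ?_⟩
    rw [rel_eq]
    split_ifs <;> simp_all
  · refine ⟨⟨x.val + t - m, by omega⟩, ?_⟩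
    rw [rel_eq]
    split_ifs <;> simp_all <;> omega

theorem eq_of_rel_eq_zero {x y : Fin m} (h : rel x y = 0) : x = y :=
  rel_right_injective ((rel_self x).trans h.symm)

theorem rel_pos {x y : Fin m} (h : x ≠ y) : 0 < rel x y :=
  Nat.pos_of_ne_zero fun e => h (eq_of_rel_eq_zero e)

/-- A property holding at the successor of `x` and stable under successors holds along the
cyclic interval from `x` to `y`. -/
theorem forall_interval {x y : Fin m} {P : Fin m → Prop} (h1 : P (cycNext x))
    (hs : ∀ z, 0 < rel x z → rel x z < rel x y → P z → P (cycNext z)) :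
    ∀ z, 0 < rel x z → rel x z ≤ rel x y → P z := by
  suffices h : ∀ t, ∀ z, rel x z = t → 0 < t → t ≤ rel x y → P z from
    fun z hz hz' => h _ z rfl hz hz'
  intro t
  induction t with
  | zero => intro z _ h; omega
  | succ t ih =>
    intro z hz _ ht
    have hlt := rel_lt x y
    rcases Nat.eq_zero_or_pos t with rfl | hpos
    · have : rel x z = rel x (cycNext x) := by
        rw [rel_cycNext, rel_self]
        split_ifs <;> omega
      rw [rel_right_injective this]
      exact h1
    · obtain ⟨w, hw⟩ := exists_rel_right x (t := t) (by omega)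
      have : rel x z = rel x (cycNext w) := by
        rw [rel_cycNext]
        split_ifs <;> omega
      rw [rel_right_injective this]
      exact hs w (by omega) (by omega) (ih w hw hpos (by omega))

/-- The chord of a height function opening at `x` and closing at `y`. -/
def IsArc (H : Fin m → ℤ) (x y : Fin m) : Prop :=
  0 < rel x y ∧ (H (cycNext y)).natAbs = (H x).natAbs ∧
    ∀ z, 0 < rel x z → rel x z ≤ rel x y → (H x).natAbs < (H z).natAbs

theorem rel_cycNext_of_lt {x y z : Fin m} (h : rel x y < rel x z) :
    rel x (cycNext y) = rel x y + 1 := by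
  have := rel_lt x z
  rw [rel_cycNext, if_neg (by omega)]

theorem rel_cycNext_self {x y : Fin m} (h : 0 < rel x y) : rel x (cycNext x) = 1 := by
  have := rel_lt x y
  rw [rel_cycNext, rel_self, if_neg (by omega)]

namespace IsArc

variable {H : Fin m → ℤ} {x y z u v x' y' : Fin m}

theorem ne (h : IsArc H x y) : x ≠ y := by
  rintro rfl
  have := h.1
  rw [rel_self] at this
  omega

theorem lt_next (h : IsArc H x y) : (H x).natAbs < (H (cycNext x)).natAbs :=
  h.2.2 _ (by rw [rel_cycNext_self h.1]; omega) (by rw [rel_cycNext_self h.1]; exact h.1)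

theorem next_lt (h : IsArc H x y) : (H (cycNext y)).natAbs < (H y).natAbs := by
  rw [h.2.1]
  exact h.2.2 _ h.1 le_rfl

theorem not_isArc (h : IsArc H x y) : ¬ IsArc H y z := fun h' => by
  have := h.next_lt
  have := h'.lt_next
  omega

theorem right_unique (h : IsArc H x y) (h' : IsArc H x y') : y = y' := by
  have key : ∀ {y y'}, IsArc H x y → IsArc H x y' → ¬ rel x y < rel x y' := by
    intro y y' h h' hlt
    have := h'.2.2 (cycNext y) (by rw [rel_cycNext_of_lt hlt]; omega)
      (by rw [rel_cycNext_of_lt hlt]; omega)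
    have := h.2.1
    omega
  exact rel_right_injective (le_antisymm (not_lt.1 (key h' h)) (not_lt.1 (key h h')))

theorem left_unique (h : IsArc H x y) (h' : IsArc H x' y) : x = x' := by
  by_contra hne
  have h1 := rel_trans x x' y
  have h2 := rel_trans x' x y
  have := rel_lt x y
  have := rel_lt x' y
  have := rel_lt x x'
  have := rel_lt x' x
  have := rel_pos hne
  have := rel_pos (Ne.symm hne)
  have e : (H x).natAbs = (H x').natAbs := h.2.1.symm.trans h'.2.1
  have h3 := h.2.2 x'
  have h4 := h'.2.2 x
  have := h.1
  have := h'.1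
  omega

theorem inside_of_inside (h : IsArc H x y) (hu : InsideCyc x y u)
    (hv : IsArc H u v ∨ IsArc H v u) : InsideCyc x y v := by
  obtain ⟨hu1, hu2⟩ := hu
  have hux := h.2.2 u hu1 hu2.le
  have hnu := h.2.2 (cycNext u) (by rw [rel_cycNext_of_lt hu2]; omega)
    (by rw [rel_cycNext_of_lt hu2]; omega)
  have hxy := h.2.1
  by_contra hv'
  have hvy : v ≠ y := by
    rintro rfl
    rcases hv with hv | hv
    · have e := h.left_unique hv
      rw [e, rel_self] at hu1
      omega
    · exact h.not_isArc hv
  have hvx : rel x v = 0 ∨ rel x y < rel x v := by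
    rcases Nat.eq_zero_or_pos (rel x v) with h0 | h0
    · exact Or.inl h0
    · have : rel x v ≠ rel x y := fun e => hvy (rel_right_injective e)
      have : ¬ rel x v < rel x y := fun e => hv' ⟨h0, e⟩
      omega
  rcases hv with hv | hv
  · have h1 := rel_trans x u v
    have h2 := rel_trans x u (cycNext y)
    have := rel_lt u v
    have := rel_lt u (cycNext y)
    have h3 : rel x (cycNext y) = 0 ∨ rel x (cycNext y) = rel x y + 1 := by
      rw [rel_cycNext]; split_ifs <;> simp
    have h4 := hv.2.2 (cycNext y)
    have := rel_lt x v
    have h5 := rel_cycNext x y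
    have := rel_lt x u
    have := hv.1
    have := rel_lt x y
    split_ifs at h5 <;> omega
  · have h1 := rel_trans v x u
    have := rel_lt v u
    have := rel_lt v x
    have := rel_lt x v
    have h2 := rel_trans x v x
    rw [rel_self] at h2
    have h6 := hv.2.1
    have h4 := hv.2.2 x
    have h3 := rel_trans x v u
    rcases Nat.eq_zero_or_pos (rel x v) with h0 | h0
    · have := eq_of_rel_eq_zero h0
      subst this
      omega
    · omega

theorem natAbs_step {H : Fin m → ℤ} (hs : ∀ i, IsHeightStep (H i) (H (cycNext i))) (i : Fin m) :
    (H (cycNext i)).natAbs = (H i).natAbs + 1 ∨ (H (cycNext i)).natAbs + 1 = (H i).natAbs ∨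
      (H i = 0 ∧ H (cycNext i) = 0) := by
  rcases hs i with h | h | h <;> omega

theorem exists_right {H : Fin m → ℤ} (hs : ∀ i, IsHeightStep (H i) (H (cycNext i))) {x : Fin m}
    (hx : (H x).natAbs < (H (cycNext x)).natAbs) : ∃ y, IsArc H x y := by
  classical
  have hm : 1 < m := by
    have h1 := rel_cycNext x x
    have := rel_lt x x
    rw [rel_self] at h1
    by_contra hm
    rw [if_pos (by omega)] at h1
    rw [← eq_of_rel_eq_zero h1] at hx
    omega
  have hex : ∃ t, 0 < t ∧ ∃ y, rel x y = t ∧ (H (cycNext y)).natAbs ≤ (H x).natAbs := by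
    obtain ⟨y, hy⟩ := exists_rel_right x (t := m - 1) (by omega)
    have h1 := rel_cycNext x y
    rw [if_pos (by omega)] at h1
    exact ⟨m - 1, by omega, y, hy, by rw [← eq_of_rel_eq_zero h1]⟩
  obtain ⟨hpos, y, hy, hle⟩ := Nat.find_spec hex
  have hmin := fun {t} => Nat.find_min (H := hex) (m := t)
  rw [← hy] at hpos hmin
  have hin := forall_interval (x := x) (y := y) (P := fun z => (H x).natAbs < (H z).natAbs) hx
    fun z hz hz' _ => by
      by_contra hlt
      exact hmin hz' ⟨hz, z, rfl, not_lt.1 hlt⟩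
  refine ⟨y, hpos, ?_, hin⟩
  have := hin y hpos le_rfl
  rcases natAbs_step hs y with h | h | h <;> omega

theorem exists_left {H : Fin m → ℤ} (hs : ∀ i, IsHeightStep (H i) (H (cycNext i))) {y : Fin m}
    (hy : (H (cycNext y)).natAbs < (H y).natAbs) : ∃ x, IsArc H x y := by
  classical
  have hex : ∃ t, 0 < t ∧ ∃ x, rel x y = t ∧ (H x).natAbs ≤ (H (cycNext y)).natAbs := by
    refine ⟨_, rel_pos (x := cycNext y) (y := y) ?_, cycNext y, rfl, le_rfl⟩
    intro h
    rw [h] at hy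
    omega
  obtain ⟨hpos, x, hx, hle⟩ := Nat.find_spec hex
  have hmin := fun {t} => Nat.find_min (H := hex) (m := t)
  rw [← hx] at hpos hmin
  have hin : ∀ z, 0 < rel x z → rel x z ≤ rel x y → (H (cycNext y)).natAbs < (H z).natAbs := by
    intro z hz hz'
    have h1 := rel_trans x z y
    have := rel_lt z y
    rcases Nat.eq_zero_or_pos (rel z y) with h0 | h0
    · rw [eq_of_rel_eq_zero h0]
      exact hy
    · by_contra hlt
      exact hmin (t := rel z y) (by omega) ⟨h0, z, rfl, not_lt.1 hlt⟩
  have hn := hin (cycNext x) (by rw [rel_cycNext_self hpos]; omega)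
    (by rw [rel_cycNext_self hpos]; omega)
  have e : (H (cycNext y)).natAbs = (H x).natAbs := by
    rcases natAbs_step hs x with h | h | h <;> omega
  exact ⟨x, hpos, e, by rwa [← e]⟩

theorem pos_iff (hs : ∀ i, IsHeightStep (H i) (H (cycNext i))) (h : IsArc H x y) :
    ∀ z, 0 < rel x z → rel x z ≤ rel x y → (0 < H z ↔ 0 < H (cycNext x)) := by
  refine forall_interval Iff.rfl fun z hz hz' ih => ?_
  rw [← ih]
  have h1 := h.2.2 z hz hz'.le
  have h2 := h.2.2 (cycNext z) (by rw [rel_cycNext_of_lt hz']; omega)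
    (by rw [rel_cycNext_of_lt hz']; omega)
  rcases hs z with h | h | h <;> omega

end IsArc

end DiagramData

namespace DiagramData

variable {m : ℕ}

theorem noncrossing_iff {b : DiagramData m} (hb : b.IsMatching) :
    b.Noncrossing ↔ ∀ x y u v, b.mate x = some y → b.mate u = some v →
      InsideCyc x y u → InsideCyc x y v := by
  constructor
  · intro h x y u v hxy huv hu
    have hyx := hb.1 _ _ hxy
    have hvu := hb.1 _ _ huv
    have := x.isLt
    have := y.isLt
    have := u.isLt
    have := v.isLt
    have hvx : v.val ≠ x.val := by
      intro e
      have e := Fin.ext e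
      subst e
      rw [hxy] at hvu
      cases hvu
      exact lt_irrefl _ hu.2
    have hvy : v.val ≠ y.val := by
      intro e
      have e := Fin.ext e
      subst e
      rw [hyx] at hvu
      cases hvu
      have := hu.1
      rw [rel_self] at this
      omega
    have h1 : ¬ (x < u ∧ u < y ∧ y < v) := fun e => h x y u v hxy huv e.1 e.2.1 e.2.2
    have h2 : ¬ (v < x ∧ x < u ∧ u < y) := fun e => h v u x y hvu hxy e.1 e.2.1 e.2.2
    have h3 : ¬ (y < v ∧ v < x ∧ x < u) := fun e => h y x v u hyx hvu e.1 e.2.1 e.2.2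
    have h4 : ¬ (u < y ∧ y < v ∧ v < x) := fun e => h u v y x huv hyx e.1 e.2.1 e.2.2
    simp only [InsideCyc, rel_eq, Fin.lt_def] at *
    split_ifs at * <;> omega
  · intro h x y u v hxy huv h1 h2 h3
    have := h x y u v hxy huv
    have := x.isLt
    have := y.isLt
    have := u.isLt
    have := v.isLt
    simp only [InsideCyc, rel_eq, Fin.lt_def] at *
    split_ifs at * <;> omega

open Classical in
/-- The diagram of a cyclic height function. -/
noncomputable def ofHeight (H : Fin m → ℤ) : DiagramData m where
  mate x := if h : ∃ y, IsArc H x y ∨ IsArc H y x then some h.choose else none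
  color x := if H x + H (cycNext x) = 1 then .red else
    if H x + H (cycNext x) = -1 then .blue else .black
  first x := decide (H x = 0 ∧ H (cycNext x) ≠ 0)

theorem ofHeight_mate_eq_some {H : Fin m → ℤ} {x y : Fin m} :
    (ofHeight H).mate x = some y ↔ IsArc H x y ∨ IsArc H y x := by
  simp only [ofHeight]
  split_ifs with h
  · have hc := h.choose_spec
    generalize h.choose = z at hc
    simp only [Option.some.injEq]
    constructor
    · rintro rfl
      exact hc
    · intro hy
      rcases hc with hc | hc <;> rcases hy with hy | hy
      · exact hc.right_unique hy
      · exact absurd hc hy.not_isArc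
      · exact absurd hy hc.not_isArc
      · exact hc.left_unique hy
  · simp only [false_iff]
    exact fun h' => h ⟨y, h'⟩

theorem ofHeight_mate_eq_none {H : Fin m → ℤ} (hs : ∀ i, IsHeightStep (H i) (H (cycNext i)))
    {x : Fin m} : (ofHeight H).mate x = none ↔ H (cycNext x) = H x := by
  rw [Option.eq_none_iff_forall_ne_some]
  simp only [ne_eq, ofHeight_mate_eq_some]
  constructor
  · intro h
    rcases IsArc.natAbs_step hs x with h' | h' | h'
    · obtain ⟨y, hy⟩ := IsArc.exists_right hs (x := x) (by omega)
      exact absurd (Or.inl hy) (h y)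
    · obtain ⟨y, hy⟩ := IsArc.exists_left hs (y := x) (by omega)
      exact absurd (Or.inr hy) (h y)
    · rw [h'.1, h'.2]
  · rintro h y (hy | hy)
    · have := hy.lt_next
      rw [h] at this
      omega
    · have := hy.next_lt
      rw [h] at this
      omega

theorem exists_last_zero {H : Fin m → ℤ} (h0 : ∃ i, H i = 0) (z : Fin m) :
    ∃ x, H x = 0 ∧ ∀ u, 0 < rel x u → rel x u ≤ rel x z → H u ≠ 0 := by
  classical
  have hex : ∃ t, ∃ x, rel x z = t ∧ H x = 0 := by
    obtain ⟨i, hi⟩ := h0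
    exact ⟨_, i, rfl, hi⟩
  obtain ⟨x, hx, hx0⟩ := Nat.find_spec hex
  refine ⟨x, hx0, fun u hu hu' hu0 => ?_⟩
  refine Nat.find_min hex (m := rel u z) ?_ ⟨u, rfl, hu0⟩
  rw [← hx]
  have := rel_trans x u z
  have := rel_lt u z
  omega

theorem exists_outer_arc {H : Fin m → ℤ} (hs : ∀ i, IsHeightStep (H i) (H (cycNext i)))
    (h0 : ∃ i, H i = 0) {z w : Fin m} (h : IsArc H z w) (hz : H z ≠ 0) :
    ∃ x y, IsArc H x y ∧ H x = 0 ∧ InsideCyc x y z ∧ InsideCyc x y w := by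
  obtain ⟨x, hx, hin⟩ := exists_last_zero h0 z
  have hxz : 0 < rel x z := rel_pos (by rintro rfl; exact hz hx)
  have hn := hin (cycNext x) (by rw [rel_cycNext_self hxz]; omega)
    (by rw [rel_cycNext_self hxz]; omega)
  obtain ⟨y, hy⟩ := IsArc.exists_right hs (x := x) (by omega)
  have hzi : InsideCyc x y z := by
    refine ⟨hxz, ?_⟩
    by_contra hlt
    rcases (not_lt.1 hlt).lt_or_eq with hlt | heq
    · refine hin (cycNext y) ?_ ?_ ?_
      · rw [rel_cycNext_of_lt hlt]; omega
      · rw [rel_cycNext_of_lt hlt]; omega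
      · have := hy.2.1
        omega
    · have := rel_right_injective heq
      subst this
      exact hy.not_isArc h
  exact ⟨x, y, hy, hx, hzi, hy.inside_of_inside hzi (Or.inl h)⟩

theorem ofHeight_color_ne_black {H : Fin m → ℤ} (hs : ∀ i, IsHeightStep (H i) (H (cycNext i)))
    {x : Fin m} : (ofHeight H).color x ≠ ChordColor.black ↔
      H (cycNext x) ≠ H x ∧ (H x = 0 ∨ H (cycNext x) = 0) := by
  have := hs x
  unfold IsHeightStep at this
  simp only [ofHeight]
  split_ifs <;> simp <;> omega

theorem IsArc.color_eq {H : Fin m → ℤ} (hs : ∀ i, IsHeightStep (H i) (H (cycNext i)))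
    {x y : Fin m} (h : IsArc H x y) : (ofHeight H).color x = (ofHeight H).color y := by
  have h1 := h.pos_iff hs y h.1 le_rfl
  have h2 := h.lt_next
  have h3 := h.next_lt
  have h4 := h.2.1
  have h5 := hs x
  have h6 := hs y
  unfold IsHeightStep at h5 h6
  have : H x + H (cycNext x) = H y + H (cycNext y) := by omega
  simp only [ofHeight, this]

theorem ofHeight_first {H : Fin m → ℤ} {x : Fin m} :
    (ofHeight H).first x = true ↔ H x = 0 ∧ H (cycNext x) ≠ 0 := by
  simp [ofHeight]

theorem IsArc.first_right {H : Fin m → ℤ} {x y : Fin m} (h : IsArc H x y) :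
    (ofHeight H).first y = false := by
  rw [← Bool.not_eq_true, ofHeight_first]
  have := h.next_lt
  omega

theorem memB_ofHeight {n p : ℕ} (hm : m = 2 * n + p) {H : Fin m → ℤ} (hH : H ∈ cyclicWalks m p) :
    (ofHeight H).MemB n := by
  obtain ⟨hs, h0, hf⟩ := hH
  have hM : (ofHeight H).IsMatching := by
    refine ⟨fun x y h => ?_, fun x h => ?_⟩
    · rw [ofHeight_mate_eq_some] at h ⊢
      exact h.symm
    · rw [ofHeight_mate_eq_some] at h
      exact (h.elim id id).ne rfl
  refine ⟨hM, (noncrossing_iff hM).2 fun x y u v hxy huv hu => ?_, ⟨fun x y h => ?_, fun x h => ?_⟩,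
    ⟨fun x h => ?_, fun x y h hc => ?_⟩, ⟨fun x y h hx z hz => ?_, fun z w h hc => ?_⟩, ?_⟩
  · rw [ofHeight_mate_eq_some] at hxy huv
    rcases hxy with hxy | hxy
    · exact hxy.inside_of_inside hu huv
    · by_contra hv
      have hvx : v ≠ x := by
        rintro rfl
        rcases huv with huv | huv
        · exact lt_irrefl _ (hxy.left_unique huv ▸ hu.2)
        · exact hxy.not_isArc huv
      have hvy : v ≠ y := by
        rintro rfl
        rcases huv with huv | huv
        · exact huv.not_isArc hxy
        · exact absurd hu.1 (by rw [hxy.right_unique huv, rel_self]; omega)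
      have hvi : InsideCyc y x v := by
        have h1 := rel_trans y x v
        have h2 := rel_trans x y v
        have h3 := rel_pos hvx.symm
        have h4 := rel_pos hvy.symm
        have h5 := rel_lt x v
        have h6 := rel_lt y v
        have h7 := rel_lt x y
        have h8 := rel_lt y x
        have h9 : rel x v ≠ rel x y := fun e => hvy (rel_right_injective e)
        unfold InsideCyc at hv ⊢
        have h10 := rel_trans x y x
        have := hxy.1
        rw [rel_self] at h10
        omega
      have := hxy.inside_of_inside hvi huv.symm
      have h1 := rel_trans y x u
      have h2 := rel_trans x y u
      have h10 := rel_trans x y x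
      have := rel_lt x u
      have := rel_lt y u
      have := rel_lt x y
      have := rel_lt y x
      rw [rel_self] at h10
      unfold InsideCyc at *
      omega
  · rw [ofHeight_mate_eq_some] at h
    rcases h with h | h
    · exact h.color_eq hs
    · exact (h.color_eq hs).symm
  · rw [ofHeight_mate_eq_none hs] at h
    by_contra hc
    exact ((ofHeight_color_ne_black hs).1 hc).1 h
  · rw [ofHeight_first] at h
    refine ⟨?_, (ofHeight_color_ne_black hs).2 ⟨by omega, Or.inl h.1⟩⟩
    rw [Option.isSome_iff_ne_none, ne_eq, ofHeight_mate_eq_none hs]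
    omega
  · rw [ofHeight_color_ne_black hs] at hc
    rw [ofHeight_mate_eq_some] at h
    rcases h with h | h
    · rw [h.first_right, Bool.not_false, ofHeight_first]
      have := h.lt_next
      omega
    · rw [h.first_right, eq_comm, Bool.not_eq_false', ofHeight_first]
      have := h.lt_next
      have := h.next_lt
      have := h.2.1
      omega
  · rw [ofHeight_first] at hx
    rw [ofHeight_mate_eq_some] at h
    rcases h with h | h
    · have h1 := h.2.2 z hz.1 hz.2.le
      have h2 := h.2.2 (cycNext z) (by rw [rel_cycNext_of_lt hz.2]; omega)
        (by rw [rel_cycNext_of_lt hz.2]; exact hz.2)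
      have := hs z
      unfold IsHeightStep at this
      refine ⟨?_, ?_⟩
      · rw [Option.isSome_iff_ne_none, ne_eq, ofHeight_mate_eq_none hs]
        omega
      · by_contra hc
        have := ((ofHeight_color_ne_black hs).1 hc).2
        omega
    · have := h.next_lt
      omega
  · have hb : ¬ (H (cycNext z) ≠ H z ∧ (H z = 0 ∨ H (cycNext z) = 0)) := by
      rw [← ofHeight_color_ne_black hs, not_not]
      exact hc
    have hne : H (cycNext z) ≠ H z := by
      rw [ne_eq, ← ofHeight_mate_eq_none hs, h]
      simp
    rw [ofHeight_mate_eq_some] at h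
    have key : ∃ x y, IsArc H x y ∧ H x = 0 ∧ InsideCyc x y z ∧ InsideCyc x y w := by
      rcases h with h | h
      · exact exists_outer_arc hs h0 h (by tauto)
      · have := h.2.1
        obtain ⟨x, y, h1, h2, h3, h4⟩ := exists_outer_arc hs h0 h
          (by have : H (cycNext z) ≠ 0 := by tauto
              omega)
        exact ⟨x, y, h1, h2, h4, h3⟩
    obtain ⟨x, y, h1, h2, h3, h4⟩ := key
    refine ⟨x, y, ofHeight_mate_eq_some.2 (Or.inl h1), ofHeight_first.2 ⟨h2, ?_⟩, h3, h4⟩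
    have := h1.lt_next
    omega
  · have e : (Finset.univ.filter fun x : Fin m => ((ofHeight H).mate x).isSome) =
        Finset.univ.filter fun x => ¬ H (cycNext x) = H x := by
      ext x
      simp only [Finset.mem_filter, Finset.mem_univ, true_and]
      rw [Option.isSome_iff_ne_none, ne_eq, ofHeight_mate_eq_none hs]
    have h1 := Finset.card_filter_add_card_filter_not (s := (Finset.univ : Finset (Fin m)))
      (fun x => H (cycNext x) = H x)
    rw [Finset.card_univ, Fintype.card_fin] at h1
    rw [e]
    omega

end DiagramData

namespace DiagramData

variable {m : ℕ}

/-- The chord on `x` and `y` starts at `x`, either because `x` is its first end or because it is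
black and `x` is the first of its two points in the inside of a red or blue chord. -/
def Starts (b : DiagramData m) (x y : Fin m) : Prop :=
  b.mate x = some y ∧ (b.first x = true ∨ (b.color x = ChordColor.black ∧
    ∃ u v, b.mate u = some v ∧ b.first u = true ∧ InsideCyc u v x ∧ rel u x < rel u y))

theorem isArc_iff_starts {H : Fin m → ℤ} (hs : ∀ i, IsHeightStep (H i) (H (cycNext i)))
    (h0 : ∃ i, H i = 0) {x y : Fin m} : IsArc H x y ↔ (ofHeight H).Starts x y := by
  constructor
  · intro h
    refine ⟨ofHeight_mate_eq_some.2 (Or.inl h), ?_⟩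
    have h1 := h.lt_next
    by_cases hx : H x = 0
    · exact Or.inl (ofHeight_first.2 ⟨hx, by omega⟩)
    · refine Or.inr ⟨?_, ?_⟩
      · by_contra hc
        have := ((ofHeight_color_ne_black hs).1 hc).2
        omega
      · obtain ⟨u, v, huv, hu, hux, huy⟩ := exists_outer_arc hs h0 h hx
        refine ⟨u, v, ofHeight_mate_eq_some.2 (Or.inl huv), ofHeight_first.2 ⟨hu, ?_⟩, hux, ?_⟩
        · have := huv.lt_next
          omega
        · have h2 := h.2.2 u
          have h3 := rel_trans u x y
          have h4 := rel_trans x u y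
          have := h.1
          have := rel_lt x y
          have := rel_lt x u
          have := rel_lt u x
          have := rel_lt u y
          have := rel_pos (x := x) (y := u) (by rintro rfl; exact hx hu)
          omega
  · rintro ⟨h, h'⟩
    rcases ofHeight_mate_eq_some.1 h with h | h
    · exact h
    · exfalso
      rcases h' with h' | ⟨hc, u, v, huv, hu, hux, hlt⟩
      · rw [h.first_right] at h'
        simp at h'
      · rw [ofHeight_first] at hu
        have h2 := h.2.2 u
        have h3 := rel_trans u y x
        have h4 := rel_trans y u x
        have := h.1
        have := rel_lt y x
        have := rel_lt y u
        have := rel_lt u x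
        have := rel_lt u y
        have := hux.1
        rcases Nat.eq_zero_or_pos (rel y u) with e | e
        · have := eq_of_rel_eq_zero e
          subst this
          rw [rel_self] at hlt
          omega
        · omega

theorem ofHeight_injOn {p : ℕ} : Set.InjOn (ofHeight (m := m)) (cyclicWalks m p) := by
  rintro H ⟨hs, h0, -⟩ K ⟨ks, k0, -⟩ e
  have harc : ∀ x y, IsArc H x y ↔ IsArc K x y := fun x y => by
    rw [isArc_iff_starts hs h0, isArc_iff_starts ks k0, e]
  have hflat : ∀ x, H (cycNext x) = H x ↔ K (cycNext x) = K x := fun x => by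
    rw [← ofHeight_mate_eq_none hs, ← ofHeight_mate_eq_none ks, e]
  have hfirst : ∀ x, (H x = 0 ∧ H (cycNext x) ≠ 0) ↔ (K x = 0 ∧ K (cycNext x) ≠ 0) := fun x => by
    rw [← ofHeight_first, ← ofHeight_first, e]
  have hup : ∀ x, (H x).natAbs < (H (cycNext x)).natAbs ↔
      (K x).natAbs < (K (cycNext x)).natAbs := fun x =>
    ⟨fun h => by
      obtain ⟨y, hy⟩ := IsArc.exists_right hs h
      exact ((harc x y).1 hy).lt_next,
    fun h => by
      obtain ⟨y, hy⟩ := IsArc.exists_right ks h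
      exact ((harc x y).2 hy).lt_next⟩
  have hcolor : ∀ x, (ofHeight H).color x = (ofHeight K).color x := fun x => by rw [e]
  have hstep : ∀ x, H x = K x → H (cycNext x) = K (cycNext x) := by
    intro x hx
    have h1 := hflat x
    have h2 := hup x
    have h3 := hs x
    have h4 := ks x
    have h5 := hcolor x
    unfold IsHeightStep at h3 h4
    simp only [ofHeight] at h5
    split_ifs at h5 <;> omega
  obtain ⟨i, hi⟩ := h0
  have hi' : K i = 0 := by
    have h1 := hflat i
    have h2 := hfirst i
    have h4 := ks i
    unfold IsHeightStep at h4
    omega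
  have hmain : ∀ t, ∀ z, rel i z = t → H z = K z := by
    intro t
    induction t with
    | zero =>
      intro z hz
      rw [← eq_of_rel_eq_zero hz, hi, hi']
    | succ t ih =>
      intro z hz
      have := rel_lt i z
      obtain ⟨w, hw⟩ := exists_rel_right i (t := t) (by omega)
      have : cycNext w = z := rel_right_injective (x := i) (by
        rw [rel_cycNext, if_neg (by omega), hw, hz])
      rw [← this]
      exact hstep w (ih w hw)
  funext z
  exact hmain _ z rfl

end DiagramData

namespace DiagramData

variable {m : ℕ}

theorem InsideCyc.rel_lt_left {u v x y : Fin m} (hx : InsideCyc u v x) (hy : InsideCyc u v y)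
    (h : rel u x < rel u y) {z : Fin m} (hz : 0 < rel x z) (hz' : rel x z ≤ rel x y) :
    InsideCyc u v z ∧ rel u x < rel u z := by
  have h1 := rel_trans u x y
  have h2 := rel_trans u x z
  have := rel_lt x y
  have := rel_lt u y
  have := rel_lt u z
  unfold InsideCyc at *
  omega

/-- The chords starting at `x` which cover the cut just before `z`. -/
def Covers (b : DiagramData m) (z x : Fin m) : Prop :=
  ∃ y, b.Starts x y ∧ 0 < rel x z ∧ rel x z ≤ rel x y

open Classical in
/-- The number of chords covering the cut just before `z`. -/
noncomputable def depth (b : DiagramData m) (z : Fin m) : ℕ :=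
  (Finset.univ.filter fun x => b.Covers z x).card

open Classical in
/-- The cyclic height function of a diagram. -/
noncomputable def height (b : DiagramData m) (z : Fin m) : ℤ :=
  if ∃ u, b.Covers z u ∧ b.first u = true ∧ b.color u = ChordColor.red then b.depth z
  else -b.depth z

theorem natAbs_height (b : DiagramData m) (z : Fin m) : (b.height z).natAbs = b.depth z := by
  unfold height
  split_ifs <;> simp

namespace MemB

variable {n : ℕ} {b : DiagramData m} {x y z u v w : Fin m}

theorem mate_symm (hb : b.MemB n) (h : b.mate x = some y) : b.mate y = some x := hb.1.1 x y h

theorem mate_ne (hb : b.MemB n) (h : b.mate x = some y) : x ≠ y := by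
  rintro rfl
  exact hb.1.2 x h

theorem inside (hb : b.MemB n) (h : b.mate x = some y) (h' : b.mate u = some v)
    (hu : InsideCyc x y u) : InsideCyc x y v :=
  (noncrossing_iff hb.1).1 hb.2.1 x y u v h h' hu

theorem color_eq (hb : b.MemB n) (h : b.mate x = some y) : b.color x = b.color y :=
  hb.2.2.1.1 x y h

theorem first_color (hb : b.MemB n) (h : b.first x = true) : b.color x ≠ ChordColor.black :=
  (hb.2.2.2.1.1 x h).2

theorem inside_first (hb : b.MemB n) (h : b.mate x = some y) (hx : b.first x = true)
    (hz : InsideCyc x y z) : (b.mate z).isSome ∧ b.color z = ChordColor.black :=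
  hb.2.2.2.2.1.1 x y h hx z hz

theorem exists_outer (hb : b.MemB n) (h : b.mate x = some y) (hx : b.color x = ChordColor.black) :
    ∃ u v, b.mate u = some v ∧ b.first u = true ∧ InsideCyc u v x ∧ InsideCyc u v y :=
  hb.2.2.2.2.1.2 x y h hx

theorem first_unique (hb : b.MemB n) {u' v' : Fin m} (h : b.mate u = some v)
    (hu : b.first u = true) (h' : b.mate u' = some v') (hu' : b.first u' = true)
    (hx : InsideCyc u v x) (hx' : InsideCyc u' v' x) : u = u' := by
  by_contra hne
  have h1 : ¬ InsideCyc u v u' := fun hi => hb.first_color hu' (hb.inside_first h hu hi).2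
  have h2 : ¬ InsideCyc u' v' u := fun hi => hb.first_color hu (hb.inside_first h' hu' hi).2
  have h3 := rel_trans u u' x
  have h4 := rel_trans u' u x
  have := rel_lt u x
  have := rel_lt u' x
  have := rel_lt u u'
  have := rel_lt u' u
  have := rel_pos hne
  have := rel_pos (Ne.symm hne)
  unfold InsideCyc at *
  omega

theorem starts_asymm (hb : b.MemB n) (h : b.Starts x y) : ¬ b.Starts y x := by
  rintro ⟨hyx, h'⟩
  obtain ⟨hxy, h⟩ := h
  have hc := hb.color_eq hxy
  rcases h with h | ⟨hc', u, v, huv, hu, hux, hlt⟩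
  · have hx := hb.first_color h
    have := hb.2.2.2.1.2 x y hxy hx
    rcases h' with h' | h'
    · simp_all
    · exact hx (hc.trans h'.1)
  · rcases h' with h' | ⟨-, u', v', huv', hu', hux', hlt'⟩
    · exact hb.first_color h' (hc ▸ hc')
    · have := hb.first_unique huv hu huv' hu' (hb.inside huv hxy hux) hux'
      subst this
      omega

theorem starts_or (hb : b.MemB n) (h : b.mate x = some y) : b.Starts x y ∨ b.Starts y x := by
  have hyx := hb.mate_symm h
  by_cases hc : b.color x = ChordColor.black
  · obtain ⟨u, v, huv, hu, hux, huy⟩ := hb.exists_outer h hc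
    have hne : rel u x ≠ rel u y := fun e => hb.mate_ne h (rel_right_injective e)
    rcases hne.lt_or_gt with hlt | hlt
    · exact Or.inl ⟨h, Or.inr ⟨hc, u, v, huv, hu, hux, hlt⟩⟩
    · exact Or.inr ⟨hyx, Or.inr ⟨hb.color_eq h ▸ hc, u, v, huv, hu, huy, hlt⟩⟩
  · have := hb.2.2.2.1.2 x y h hc
    by_cases hx : b.first x = true
    · exact Or.inl ⟨h, Or.inl hx⟩
    · refine Or.inr ⟨hyx, Or.inl ?_⟩
      simp_all

theorem starts_right_unique {y' : Fin m} (h : b.Starts x y) (h' : b.Starts x y') : y = y' :=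
  Option.some.inj (h.1.symm.trans h'.1)

theorem starts_left_unique (hb : b.MemB n) {x' : Fin m} (h : b.Starts x y) (h' : b.Starts x' y) :
    x = x' :=
  Option.some.inj ((hb.mate_symm h.1).symm.trans (hb.mate_symm h'.1))

theorem not_starts_trans (hb : b.MemB n) (h : b.Starts x y) : ¬ b.Starts y z := by
  intro h'
  have := Option.some.inj ((hb.mate_symm h.1).symm.trans h'.1)
  subst this
  exact absurd h' (hb.starts_asymm h)

/-- Points inside a chord are black, and their chords point the same way. -/
theorem inside_starts (hb : b.MemB n) (h : b.Starts x y) (hz : InsideCyc x y z) :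
    (b.mate z).isSome ∧ b.color z = ChordColor.black ∧
      ∀ w, b.Starts z w → rel x z < rel x w := by
  have key : ∃ u v, b.mate u = some v ∧ b.first u = true ∧ InsideCyc u v z ∧
      ∀ w, b.Starts z w → rel u z < rel u w → rel x z < rel x w := by
    obtain ⟨hxy, h | ⟨hc, u, v, huv, hu, hux, hlt⟩⟩ := h
    · exact ⟨x, y, hxy, h, hz, fun w _ h => h⟩
    · obtain ⟨h1, h2⟩ := hux.rel_lt_left (hb.inside huv hxy hux) hlt hz.1 hz.2.le
      refine ⟨u, v, huv, hu, h1, fun w hw hlt' => ?_⟩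
      have h3 := hb.inside hxy hw.1 hz
      have h4 := hux.rel_lt_left (hb.inside huv hxy hux) hlt h3.1 h3.2.le
      have h5 := rel_trans u x z
      have h6 := rel_trans u x w
      have := rel_lt u w
      have := rel_lt u z
      have := rel_lt x w
      have := rel_lt x z
      omega
  obtain ⟨u, v, huv, hu, huz, hlt⟩ := key
  obtain ⟨h1, h2⟩ := hb.inside_first huv hu huz
  refine ⟨h1, h2, fun w hw => hlt w hw ?_⟩
  obtain ⟨hzw, hw | ⟨hc, u', v', huv', hu', huz', hlt'⟩⟩ := hw
  · exact absurd h2 (hb.first_color hw)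
  · rwa [hb.first_unique huv hu huv' hu' huz huz']

theorem starts_rel_pos (hb : b.MemB n) (h : b.Starts x y) : 0 < rel x y :=
  rel_pos (hb.mate_ne h.1)

theorem covers_cycNext (hb : b.MemB n) :
    b.Covers (cycNext z) x ↔ (x = z ∧ ∃ y, b.Starts z y) ∨ (b.Covers z x ∧ ¬ b.Starts x z) := by
  by_cases hx : x = z
  · subst hx
    have h1 : ¬ b.Starts x x := fun h => hb.mate_ne h.1 rfl
    simp only [Covers, rel_self, lt_irrefl, false_and, and_false, exists_false, or_false, true_and]
    refine exists_congr fun y => ⟨fun h => h.1, fun h => ⟨h, ?_⟩⟩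
    have := hb.starts_rel_pos h
    rw [rel_cycNext_self this]
    omega
  · simp only [hx, false_and, false_or]
    have hpos := rel_pos hx
    constructor
    · rintro ⟨y, hxy, h1, h2⟩
      have h3 := rel_cycNext x z
      have := rel_lt x z
      refine ⟨⟨y, hxy, hpos, ?_⟩, fun h => ?_⟩
      · split_ifs at h3 <;> omega
      · have := starts_right_unique hxy h
        subst this
        split_ifs at h3 <;> omega
    · rintro ⟨⟨y, hxy, h1, h2⟩, h⟩
      have h3 : rel x z ≠ rel x y := by
        intro e
        rw [rel_right_injective e] at h
        exact h hxy
      have h4 := rel_cycNext_of_lt (x := x) (y := z) (z := y) (by omega)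
      exact ⟨y, hxy, by omega, by omega⟩

theorem not_covers_self : ¬ b.Covers z z := by
  rintro ⟨y, -, h, -⟩
  rw [rel_self] at h
  omega

theorem covers_end (hb : b.MemB n) (h : b.Starts x y) : b.Covers y x :=
  ⟨y, h, hb.starts_rel_pos h, le_rfl⟩

theorem covers_inside (h : b.Covers z x) (hxz : ¬ b.Starts x z) :
    ∃ y, b.Starts x y ∧ InsideCyc x y z := by
  obtain ⟨y, hxy, h1, h2⟩ := h
  refine ⟨y, hxy, h1, lt_of_le_of_ne h2 fun e => ?_⟩
  rw [rel_right_injective e] at hxz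
  exact hxz hxy

theorem covers_of_inside (h : b.Starts x y) (hz : InsideCyc x y z) : b.Covers z x :=
  ⟨y, h, hz.1, hz.2.le⟩

theorem depth_eq_zero_iff' : b.depth z = 0 ↔ ∀ x, ¬ b.Covers z x := by
  simp [depth, Finset.filter_eq_empty_iff]

theorem depth_start (hb : b.MemB n) (h : b.Starts z y) : b.depth (cycNext z) = b.depth z + 1 := by
  classical
  unfold depth
  rw [← Finset.card_insert_of_notMem (a := z) (by simpa using not_covers_self)]
  congr 1
  ext x
  simp only [Finset.mem_filter, Finset.mem_univ, true_and, Finset.mem_insert, hb.covers_cycNext]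
  have : ¬ b.Starts x z := fun h' => hb.not_starts_trans h' h
  have : ∃ y, b.Starts z y := ⟨y, h⟩
  tauto

theorem depth_end (hb : b.MemB n) (h : b.Starts x z) : b.depth (cycNext z) + 1 = b.depth z := by
  classical
  unfold depth
  rw [← Finset.card_insert_of_notMem (a := x)]
  · congr 1
    ext w
    simp only [Finset.mem_filter, Finset.mem_univ, true_and, Finset.mem_insert, hb.covers_cycNext]
    have h1 : ¬ ∃ y, b.Starts z y := fun ⟨y, h'⟩ => hb.not_starts_trans h h'
    have h2 : b.Starts w z ↔ w = x :=
      ⟨fun h' => hb.starts_left_unique h' h, fun h' => h' ▸ h⟩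
    have h3 := hb.covers_end h
    by_cases hw : w = x
    · subst hw; tauto
    · tauto
  · simp only [Finset.mem_filter, Finset.mem_univ, true_and, hb.covers_cycNext]
    have h1 : ¬ ∃ y, b.Starts z y := fun ⟨y, h'⟩ => hb.not_starts_trans h h'
    tauto

theorem depth_bare (hb : b.MemB n) (h : b.mate z = none) :
    b.depth (cycNext z) = b.depth z := by
  classical
  unfold depth
  congr 1
  ext w
  simp only [Finset.mem_filter, Finset.mem_univ, true_and, hb.covers_cycNext]
  have h1 : ¬ ∃ y, b.Starts z y := fun ⟨y, h'⟩ => by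
    have := h'.1
    simp_all
  have h2 : ¬ b.Starts w z := fun h' => by
    have := hb.mate_symm h'.1
    simp_all
  tauto

theorem depth_eq_zero_iff (hb : b.MemB n) :
    b.depth z = 0 ↔ b.mate z = none ∨ b.first z = true := by
  rw [depth_eq_zero_iff']
  constructor
  · intro h
    by_contra! hne
    obtain ⟨w, hw⟩ := Option.ne_none_iff_exists'.1 hne.1
    by_cases hc : b.color z = ChordColor.black
    · obtain ⟨u, v, huv, hu, huz, -⟩ := hb.exists_outer hw hc
      exact h u (covers_of_inside ⟨huv, Or.inl hu⟩ huz)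
    · rcases hb.starts_or hw with h' | h'
      · obtain ⟨-, h' | h'⟩ := h'
        · exact hne.2 h'
        · exact hc h'.1
      · exact h w (hb.covers_end h')
  · rintro h x hx
    have hxz : ¬ b.Starts x z := by
      intro h'
      have hm := hb.mate_symm h'.1
      rcases h with h | h
      · simp_all
      · exact hb.not_starts_trans h' ⟨hm, Or.inl h⟩
    obtain ⟨y, hxy, hin⟩ := covers_inside hx hxz
    obtain ⟨h1, h2, -⟩ := hb.inside_starts hxy hin
    rcases h with h | h
    · simp_all
    · exact hb.first_color h h2

theorem cases_point (hb : b.MemB n) (z : Fin m) :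
    b.mate z = none ∨ (∃ y, b.Starts z y) ∨ ∃ x, b.Starts x z := by
  rcases Option.eq_none_or_eq_some (b.mate z) with h | ⟨w, hw⟩
  · exact Or.inl h
  · exact Or.inr ((hb.starts_or hw).imp (fun h => ⟨w, h⟩) fun h => ⟨w, h⟩)

/-- The colour covering a cut does not change across a point as long as the depth is positive. -/
theorem red_cycNext (hb : b.MemB n) (h0 : b.depth z ≠ 0) (h1 : b.depth (cycNext z) ≠ 0) :
    (∃ u, b.Covers (cycNext z) u ∧ b.first u = true ∧ b.color u = ChordColor.red) ↔
      ∃ u, b.Covers z u ∧ b.first u = true ∧ b.color u = ChordColor.red := by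
  rw [ne_eq, hb.depth_eq_zero_iff, not_or] at h0
  refine exists_congr fun u => and_congr_left fun hu => ?_
  rw [hb.covers_cycNext]
  constructor
  · rintro (⟨rfl, -⟩ | h)
    · exact absurd hu.1 h0.2
    · exact h.1
  · intro h
    refine Or.inr ⟨h, fun huz => ?_⟩
    rw [ne_eq, depth_eq_zero_iff'] at h1
    push Not at h1
    obtain ⟨w, hw⟩ := h1
    rw [hb.covers_cycNext] at hw
    rcases hw with ⟨-, y, hy⟩ | ⟨hw, hwz⟩
    · exact hb.not_starts_trans huz hy
    · obtain ⟨y, hwy, hin⟩ := covers_inside hw hwz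
      have := (hb.inside_starts hwy hin).2.1
      rw [← hb.color_eq huz.1] at this
      exact hb.first_color hu.1 this

theorem isHeightStep (hb : b.MemB n) (z : Fin m) :
    IsHeightStep (b.height z) (b.height (cycNext z)) := by
  have hr := fun h0 h1 => hb.red_cycNext (z := z) h0 h1
  have h0 := hb.depth_eq_zero_iff (z := z)
  have hcase : b.depth (cycNext z) = b.depth z + 1 ∨ b.depth (cycNext z) + 1 = b.depth z ∨
      (b.depth z = 0 ∧ b.depth (cycNext z) = 0) := by
    rcases hb.cases_point z with h | ⟨y, h⟩ | ⟨x, h⟩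
    · have := hb.depth_bare h
      have := h0.2 (Or.inl h)
      omega
    · exact Or.inl (hb.depth_start h)
    · exact Or.inr (Or.inl (hb.depth_end h))
  clear h0
  by_cases h0 : b.depth z = 0
  · simp only [height, IsHeightStep, h0]
    split_ifs <;> omega
  by_cases h1 : b.depth (cycNext z) = 0
  · simp only [height, IsHeightStep, h1]
    split_ifs <;> omega
  specialize hr h0 h1
  simp only [height, IsHeightStep]
  split_ifs with h2 h3 h3
  · omega
  · exact absurd (hr.1 h2) h3
  · exact absurd (hr.2 h3) h2
  · omega

theorem height_eq_zero_iff (hb : b.MemB n) :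
    b.height z = 0 ↔ b.mate z = none ∨ b.first z = true := by
  rw [← hb.depth_eq_zero_iff, ← natAbs_height, Int.natAbs_eq_zero]

theorem height_flat_iff (hb : b.MemB n) : b.height (cycNext z) = b.height z ↔ b.mate z = none := by
  have h1 := b.natAbs_height z
  have h2 := b.natAbs_height (cycNext z)
  rcases hb.cases_point z with h | ⟨y, h⟩ | ⟨x, h⟩
  · have := hb.depth_bare h
    have := hb.depth_eq_zero_iff.2 (Or.inl h)
    simp only [h, iff_true]
    omega
  · have := hb.depth_start h
    simp only [h.1, reduceCtorEq, iff_false]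
    omega
  · have := hb.depth_end h
    simp only [hb.mate_symm h.1, reduceCtorEq, iff_false]
    omega

theorem height_mem {p : ℕ} (hm : m = 2 * n + p) (hn : 0 < n) (hb : b.MemB n) :
    b.height ∈ cyclicWalks m p := by
  refine ⟨hb.isHeightStep, ?_, ?_⟩
  · simp only [hb.height_eq_zero_iff]
    by_contra! hne
    obtain ⟨w, hw⟩ := Option.ne_none_iff_exists'.1 (hne ⟨0, by omega⟩).1
    by_cases hc : b.color ⟨0, by omega⟩ = ChordColor.black
    · obtain ⟨u, v, huv, hu, -⟩ := hb.exists_outer hw hc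
      exact (hne u).2 hu
    · rcases hb.starts_or hw with ⟨-, h | h⟩ | ⟨-, h | h⟩
      · exact (hne _).2 h
      · exact hc h.1
      · exact (hne _).2 h
      · exact hc (hb.color_eq hw ▸ h.1)
  · have e : (Finset.univ.filter fun x : Fin m => (b.mate x).isSome) =
        Finset.univ.filter fun x => ¬ b.height (cycNext x) = b.height x := by
      ext x
      simp only [Finset.mem_filter, Finset.mem_univ, true_and]
      rw [Option.isSome_iff_ne_none, ne_eq, hb.height_flat_iff]
    have h1 := Finset.card_filter_add_card_filter_not (s := (Finset.univ : Finset (Fin m)))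
      (fun x => b.height (cycNext x) = b.height x)
    rw [Finset.card_univ, Fintype.card_fin] at h1
    have h2 := hb.2.2.2.2.2
    rw [e] at h2
    omega

theorem isArc_height (hb : b.MemB n) (h : b.Starts x y) : IsArc b.height x y := by
  classical
  have hsub : ∀ w, b.Covers x w → ∃ w', b.Starts w w' ∧ InsideCyc w w' x ∧ InsideCyc w w' y := by
    intro w hw
    obtain ⟨w', hw', hin⟩ := covers_inside hw fun h' => hb.not_starts_trans h' h
    exact ⟨w', hw', hin, hb.inside hw'.1 h.1 hin⟩
  refine ⟨hb.starts_rel_pos h, ?_, fun z hz hz' => ?_⟩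
  · rw [natAbs_height, natAbs_height]
    have h1 := hb.depth_end h
    suffices b.depth y = b.depth x + 1 by omega
    unfold depth
    rw [← Finset.card_insert_of_notMem (a := x) (by simpa using not_covers_self)]
    congr 1
    ext w
    simp only [Finset.mem_filter, Finset.mem_univ, true_and, Finset.mem_insert]
    constructor
    · intro hw
      by_cases hwy : b.Starts w y
      · exact Or.inl (hb.starts_left_unique hwy h)
      · obtain ⟨w', hw', hin⟩ := covers_inside hw hwy
        exact Or.inr (covers_of_inside hw' (hb.inside hw'.1 (hb.mate_symm h.1) hin))
    · rintro (rfl | hw)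
      · exact hb.covers_end h
      · obtain ⟨w', hw', -, hin⟩ := hsub w hw
        exact covers_of_inside hw' hin
  · rw [natAbs_height, natAbs_height]
    refine Finset.card_lt_card (Finset.ssubset_iff_of_subset ?_ |>.2 ⟨x, ?_, ?_⟩)
    · intro w
      simp only [Finset.mem_filter, Finset.mem_univ, true_and]
      intro hw
      obtain ⟨w', hw', hin, hin'⟩ := hsub w hw
      have := (hb.inside_starts hw' hin).2.2 y h
      exact covers_of_inside hw' (hin.rel_lt_left hin' this hz hz').1
    · simpa using ⟨y, h, hz, hz'⟩
    · simpa using not_covers_self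

theorem isArc_height_iff (hb : b.MemB n) : IsArc b.height x y ↔ b.Starts x y := by
  refine ⟨fun h => ?_, hb.isArc_height⟩
  rcases hb.cases_point x with h' | ⟨w, h'⟩ | ⟨w, h'⟩
  · have := h.lt_next
    rw [hb.height_flat_iff.2 h'] at this
    omega
  · rwa [h.right_unique (hb.isArc_height h')]
  · exact absurd h (hb.isArc_height h').not_isArc

theorem ofHeight_height_mate (hb : b.MemB n) : (ofHeight b.height).mate = b.mate := by
  funext x
  rcases Option.eq_none_or_eq_some (b.mate x) with h | ⟨y, h⟩
  · rw [h, ofHeight_mate_eq_none hb.isHeightStep, hb.height_flat_iff, h]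
  · rw [h, ofHeight_mate_eq_some, hb.isArc_height_iff, hb.isArc_height_iff]
    exact hb.starts_or h

theorem ofHeight_height_first (hb : b.MemB n) : (ofHeight b.height).first = b.first := by
  funext x
  rw [Bool.eq_iff_iff, ofHeight_first, hb.height_eq_zero_iff]
  have h1 := hb.height_flat_iff (z := x)
  have h2 := hb.height_eq_zero_iff (z := x)
  constructor
  · rintro ⟨h | h, h'⟩
    · exact absurd (h1.2 h ▸ h2.2 (Or.inl h)) h'
    · exact h
  · intro h
    refine ⟨Or.inr h, ?_⟩
    rw [← h2.2 (Or.inr h), ne_eq, h1]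
    have := (hb.2.2.2.1.1 x h).1
    rwa [Option.isSome_iff_ne_none] at this

theorem ofHeight_height_color (hb : b.MemB n) : (ofHeight b.height).color = b.color := by
  have hs := hb.isHeightStep
  have hfirst : ∀ x y, b.Starts x y → b.first x = true →
      (ofHeight b.height).color x = b.color x := by
    intro x y h hx
    have hx0 := hb.depth_eq_zero_iff.2 (Or.inr hx)
    have hx0' := hb.height_eq_zero_iff.2 (Or.inr hx)
    have hx1 := hb.depth_start h
    have hred : (∃ u, b.Covers (cycNext x) u ∧ b.first u = true ∧
        b.color u = ChordColor.red) ↔ b.color x = ChordColor.red := by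
      have : ∀ u, b.Covers (cycNext x) u ↔ u = x := by
        intro u
        rw [hb.covers_cycNext]
        have := depth_eq_zero_iff'.1 hx0 u
        have : ∃ y, b.Starts x y := ⟨y, h⟩
        tauto
      simp [this, hx]
    have hc := hb.first_color hx
    have hh : b.height (cycNext x) = if b.color x = ChordColor.red then 1 else -1 := by
      simp only [height, hred, hx1, hx0]
      simp
    simp only [ofHeight, hx0', hh, zero_add]
    cases hcx : b.color x <;> simp_all
  funext x
  by_cases hc : b.color x = ChordColor.black
  · rw [hc]
    by_contra hne
    obtain ⟨h1, h2⟩ := (ofHeight_color_ne_black hs).1 hne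
    rw [ne_eq, hb.height_flat_iff] at h1
    rw [hb.height_eq_zero_iff] at h2
    have hx0 : ∀ w, b.color w = ChordColor.black → b.mate w ≠ none → b.depth w ≠ 0 := by
      intro w hw hw'
      rw [ne_eq, hb.depth_eq_zero_iff]
      rintro (h | h)
      · exact hw' h
      · exact hb.first_color h hw
    have h3 : b.height (cycNext x) = 0 := by
      rcases h2 with (h2 | h2) | h2
      · exact absurd h2 h1
      · exact absurd hc (hb.first_color h2)
      · exact h2
    have h4 := b.natAbs_height (cycNext x)
    rw [h3, Int.natAbs_zero] at h4
    rcases hb.cases_point x with h | ⟨y, h⟩ | ⟨w, h⟩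
    · exact h1 h
    · have := hb.depth_start h
      omega
    · have h5 := (hb.isArc_height h).2.1
      rw [h3, natAbs_height] at h5
      refine hx0 w (hb.color_eq h.1 ▸ hc) ?_ h5.symm
      rw [h.1]
      simp
  · rcases hb.cases_point x with h | ⟨y, h⟩ | ⟨w, h⟩
    · exact absurd (hb.2.2.1.2 x h) hc
    · obtain ⟨-, h' | h'⟩ := id h
      · exact hfirst x y h h'
      · exact absurd h'.1 hc
    · have e := hb.color_eq h.1
      obtain ⟨-, h' | h'⟩ := id h
      · rw [← (hb.isArc_height h).color_eq hs, hfirst w x h h', e]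
      · exact absurd (e ▸ h'.1) hc

theorem ofHeight_height (hb : b.MemB n) : ofHeight b.height = b := by
  have h1 := hb.ofHeight_height_mate
  have h2 := hb.ofHeight_height_color
  have h3 := hb.ofHeight_height_first
  cases b
  cases h : ofHeight (height _)
  rw [h] at h1 h2 h3
  simp_all

end MemB

theorem card_memB_eq_ncard {n p : ℕ} (hm : m = 2 * n + p) (hn : 0 < n) :
    Nat.card {b : DiagramData m // b.MemB n} = (cyclicWalks m p).ncard := by
  have e : {b : DiagramData m | b.MemB n} = ofHeight '' cyclicWalks m p := by
    ext b
    constructor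
    · intro hb
      exact ⟨b.height, MemB.height_mem hm hn hb, MemB.ofHeight_height hb⟩
    · rintro ⟨H, hH, rfl⟩
      exact memB_ofHeight hm hH
  rw [← ofHeight_injOn.ncard_image, ← e]
  exact Nat.card_coe_set_eq _

end DiagramData

/-- **Lemma (coefficient extraction).** For all `d ≥ 2` and `k ≥ 0`,
`|𝓑_{⌊d/2⌋+1, 2⌊d/2⌋+2+dk}| = ((2dk+4⌊d/2⌋+4)(2dk+4⌊d/2⌋)⋯(2dk+4)) / (⌊d/2⌋+1)!`,
the numerator being the product of the `⌊d/2⌋+1` terms `2dk+4s`, `s = 1, …, ⌊d/2⌋+1`. -/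
theorem card_B_eq_product (d k : ℕ) (hd : 2 ≤ d) :
    (Nat.card {b : DiagramData (2 * (d / 2) + 2 + d * k) // b.MemB (d / 2 + 1)} : ℝ) =
      (∏ s ∈ Finset.Icc 1 (d / 2 + 1), (2 * (d : ℝ) * k + 4 * s)) /
        (Nat.factorial (d / 2 + 1) : ℝ) := by
  have h := factorial_mul_ncard_cyclicWalks (d / 2 + 1) (d * k) (Nat.succ_pos _)
  rw [← DiagramData.card_memB_eq_ncard rfl (Nat.succ_pos _)] at h
  rw [eq_div_iff (by positivity), mul_comm]
  refine h.trans ?_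
  rw [← Finset.Ico_add_one_right_eq_Icc, Finset.prod_Ico_eq_prod_range]
  refine Finset.prod_congr (by simp) fun s _ => ?_
  push_cast
  ring
end

section
/- Let b ∈ B_{n,2j} be an element on an even number 2j of points, and let s(b) be the binary string of length j whose ℓ-th entry (1 ≤ ℓ ≤ j) is 0 if point 2ℓ-1 of b is bare and 1 otherwise. Then s(b) contains exactly n ones; equivalently, every chord of b joins an odd-indexed point to an even-indexed point. -/
namespace DiagramData

variable {m : ℕ}

theorem insideCyc_iff (a c z : Fin m) :
    InsideCyc a c z ↔ (a < z ∧ z < c) ∨ (c < a ∧ (a < z ∨ z < c)) := by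
  have key : ∀ y : Fin m, rel a y = if a.val ≤ y.val then y.val - a.val else y.val + m - a.val := by
    intro y
    unfold rel
    split_ifs with h
    · rw [show y.val + m - a.val = (y.val - a.val) + m by omega, Nat.add_mod_right]
      exact Nat.mod_eq_of_lt (by omega)
    · exact Nat.mod_eq_of_lt (by omega)
  unfold InsideCyc
  simp only [key, Fin.lt_def]
  split_ifs <;> omega

/-- A set of matched points that is stable under `mate` has even cardinality. -/
theorem IsMatching.even_card {b : DiagramData m} (hb : b.IsMatching) (s : Finset (Fin m))
    (hs : ∀ z ∈ s, ∃ w ∈ s, b.mate z = some w) : Even s.card := by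
  choose! f hf hmate using hs
  have h : ∑ _z ∈ s, (1 : ZMod 2) = 0 := by
    refine Finset.sum_involution (fun z _ => f z) (fun _ _ => by decide) ?_ hf ?_
    · intro z hz _ h
      exact hb.2 z (by rw [hmate z hz]; exact congrArg some h)
    · intro z hz
      have h := hb.1 _ _ (hmate z hz)
      rw [hmate _ (hf z hz)] at h
      exact Option.some_injective _ h
  rw [Finset.sum_const, nsmul_eq_mul, mul_one] at h
  exact (ZMod.natCast_eq_zero_iff_even).mp h

/-- Every point on one of the two sides of a chord is matched. -/
theorem MemB.side_isSome {n : ℕ} {b : DiagramData m} (hb : b.MemB n) {x y : Fin m}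
    (hxy : b.mate x = some y) (hlt : x < y) :
    (∀ z, x < z → z < y → (b.mate z).isSome) ∨ (∀ z, z < x ∨ y < z → (b.mate z).isSome) := by
  obtain ⟨hm, -, -, hf, hi, -⟩ := hb
  have inside : ∀ p q, b.mate p = some q → b.first p = true →
      ∀ z, (p < z ∧ z < q) ∨ (q < p ∧ (p < z ∨ z < q)) → (b.mate z).isSome :=
    fun p q hpq hp z hz => (hi.1 p q hpq hp z ((insideCyc_iff p q z).mpr hz)).1
  by_cases hc : b.color x = ChordColor.black
  · obtain ⟨p, q, hpq, hp, hx, hy⟩ := hi.2 x y hxy hc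
    rw [insideCyc_iff] at hx hy
    by_cases h : x < q ∧ q < p ∧ p < y
    · exact Or.inr fun z hz => inside p q hpq hp z (by omega)
    · exact Or.inl fun z h1 h2 => inside p q hpq hp z (by omega)
  · have h := hf.2 x y hxy hc
    cases hy : b.first y
    · rw [hy] at h
      exact Or.inl fun z h1 h2 => inside x y hxy h z (Or.inl ⟨h1, h2⟩)
    · exact Or.inr fun z hz => inside y x (hm.1 x y hxy) hy z (by omega)

/-- On an even number of points, the ends of a chord have different parities. -/
theorem MemB.mod_two_ne_of_lt {n : ℕ} {b : DiagramData m} (hb : b.MemB n) (he : Even m)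
    {x y : Fin m} (hxy : b.mate x = some y) (hlt : x < y) : x.val % 2 ≠ y.val % 2 := by
  have hm := hb.1
  have hnc := hb.2.1
  have hyx := hm.1 x y hxy
  have sep : ∀ z w, b.mate z = some w → z ≠ x → z ≠ y →
      w ≠ x ∧ w ≠ y ∧ ((x < z ∧ z < y) ↔ (x < w ∧ w < y)) := by
    intro z w hzw hzx hzy
    have hwz := hm.1 z w hzw
    have hwx : w ≠ x := by
      rintro rfl
      exact hzy (Option.some_injective _ (hwz.symm.trans hxy))
    have hwy : w ≠ y := by
      rintro rfl
      exact hzx (Option.some_injective _ (hwz.symm.trans hyx))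
    have h1 := hnc x y z w hxy hzw
    have h2 := hnc x y w z hxy hwz
    have h3 := hnc z w x y hzw hxy
    have h4 := hnc w z x y hwz hxy
    refine ⟨hwx, hwy, ?_⟩
    grind
  have card_in : (Finset.Ioo x y).card = y.val - x.val - 1 := Fin.card_Ioo x y
  have card_Icc : (Finset.Icc x y).card = y.val + 1 - x.val := Fin.card_Icc x y
  rcases hb.side_isSome hxy hlt with h | h
  · have := hm.even_card (Finset.Ioo x y) fun z hz => by
      rw [Finset.mem_Ioo] at hz
      obtain ⟨w, hw⟩ := Option.isSome_iff_exists.mp (h z hz.1 hz.2)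
      have := sep z w hw (by omega) (by omega)
      exact ⟨w, Finset.mem_Ioo.mpr (this.2.2.mp hz), hw⟩
    rw [card_in, Nat.even_iff] at this
    omega
  · have := hm.even_card (Finset.Icc x y)ᶜ fun z hz => by
      rw [Finset.mem_compl, Finset.mem_Icc] at hz
      obtain ⟨w, hw⟩ := Option.isSome_iff_exists.mp (h z (by omega))
      have := sep z w hw (by omega) (by omega)
      refine ⟨w, ?_, hw⟩
      rw [Finset.mem_compl, Finset.mem_Icc]
      omega
    rw [Finset.card_compl, Fintype.card_fin, card_Icc, Nat.even_iff] at this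
    rw [Nat.even_iff] at he
    omega

theorem MemB.mod_two_ne {n : ℕ} {b : DiagramData m} (hb : b.MemB n) (he : Even m)
    {x y : Fin m} (hxy : b.mate x = some y) : x.val % 2 ≠ y.val % 2 := by
  rcases lt_trichotomy x y with h | rfl | h
  · exact hb.mod_two_ne_of_lt he hxy h
  · exact absurd hxy (hb.1.2 x)
  · exact (hb.mod_two_ne_of_lt he (hb.1.1 x y hxy) h).symm

/-- If chords join points of different parities, exactly half of the matched points are even. -/
theorem IsMatching.two_mul_card_even {b : DiagramData m} (hb : b.IsMatching)
    (hpar : ∀ x y, b.mate x = some y → x.val % 2 ≠ y.val % 2) :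
    2 * (Finset.univ.filter fun x : Fin m => (b.mate x).isSome ∧ x.val % 2 = 0).card =
      (Finset.univ.filter fun x : Fin m => (b.mate x).isSome).card := by
  have hinj : ∀ x y (hx : (b.mate x).isSome) (hy : (b.mate y).isSome),
      (b.mate x).get hx = (b.mate y).get hy → x = y := by
    intro x y hx hy h
    have h1 := hb.1 x _ (Option.some_get hx).symm
    have h2 := hb.1 y _ (Option.some_get hy).symm
    rw [h, h2] at h1
    exact (Option.some_injective _ h1).symm
  have heq : (Finset.univ.filter fun x : Fin m => (b.mate x).isSome ∧ x.val % 2 = 0).card =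
      (Finset.univ.filter fun x : Fin m => (b.mate x).isSome ∧ ¬ x.val % 2 = 0).card := by
    refine Finset.card_bij (fun x hx => (b.mate x).get (Finset.mem_filter.mp hx).2.1) ?_ ?_ ?_
    · intro x hx
      have hx' := (Finset.mem_filter.mp hx).2
      have hs := (Option.some_get hx'.1).symm
      refine Finset.mem_filter.mpr ⟨Finset.mem_univ _, ?_, ?_⟩
      · rw [hb.1 _ _ hs]; rfl
      · exact fun h => hpar _ _ hs (hx'.2.trans h.symm)
    · exact fun x _ y _ h => hinj _ _ _ _ h
    · intro y hy
      have hy' := (Finset.mem_filter.mp hy).2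
      obtain ⟨x, hyx⟩ := Option.isSome_iff_exists.mp hy'.1
      have hxy := hb.1 y x hyx
      have := hpar y x hyx
      exact ⟨x, Finset.mem_filter.mpr ⟨Finset.mem_univ _, by rw [hxy]; rfl, by omega⟩,
        by simp [hxy]⟩
  have := Finset.card_filter_add_card_filter_not
    (s := Finset.univ.filter fun x : Fin m => (b.mate x).isSome) (fun x : Fin m => x.val % 2 = 0)
  rw [Finset.filter_filter, Finset.filter_filter] at this
  omega

end DiagramData

/-- **Lemma (first half of Lemma `remove the 2s`).** For `b ∈ 𝓑_{n,2j}`, the binary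
string `s(b)` (whose `ℓ`-th entry records whether point `2ℓ-1` of `b` is bare) has
exactly `n` ones; equivalently, every chord of `b` joins an odd-indexed point to an
even-indexed point. -/
theorem string_of_diagram_has_n_ones (n j : ℕ) (b : DiagramData (2 * j))
    (hb : b.MemB n) :
    (Finset.univ.filter fun ℓ : Fin j =>
        (b.mate ⟨2 * ℓ.val, by have := ℓ.isLt; omega⟩).isSome).card = n ∧
      ∀ x y, b.mate x = some y → x.val % 2 ≠ y.val % 2 := by
  have hpar : ∀ x y, b.mate x = some y → x.val % 2 ≠ y.val % 2 :=
    fun x y hxy => hb.mod_two_ne (even_two_mul j) hxy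
  refine ⟨?_, hpar⟩
  have hcard := hb.1.two_mul_card_even hpar
  rw [hb.2.2.2.2.2] at hcard
  refine Eq.trans ?_ (Nat.eq_of_mul_eq_mul_left two_pos hcard)
  refine Finset.card_bij (fun ℓ _ => ⟨2 * ℓ.val, by have := ℓ.isLt; omega⟩) ?_ ?_ ?_
  · intro ℓ hℓ
    exact Finset.mem_filter.mpr
      ⟨Finset.mem_univ _, (Finset.mem_filter.mp hℓ).2, Nat.mul_mod_right 2 ℓ.val⟩
  · intro ℓ _ k _ h
    have := congrArg Fin.val h
    dsimp only at this
    omega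
  · intro x hx
    obtain ⟨-, hs, h0⟩ := Finset.mem_filter.mp hx
    have hx2 : (⟨2 * (x.val / 2), by omega⟩ : Fin (2 * j)) = x := Fin.ext (by dsimp only; omega)
    exact ⟨⟨x.val / 2, by omega⟩,
      Finset.mem_filter.mpr ⟨Finset.mem_univ _, by dsimp only; rw [hx2]; exact hs⟩, hx2⟩
end

section
/- Let d ≥ 2 be even and i ≥ 1. Then (-1)^{i-1} · Σ_{k=0}^{i-1} binom(i-1, k) (-1)^k binom(d/2·(k+1)+1, d/2+1) equals the number of lattice walks from (0,0) to (d/2+1, d(i-1)/2) using unit steps right and up, with the additional property that for each j with 0 ≤ j ≤ i-2 the number of up steps taken at x-coordinate j is strictly less than d/2. -/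
/-- The number of up steps that a lattice walk takes at `x`-coordinate `j`. -/
def columnUps : List (ℤ × ℤ) → ℕ → ℕ
  | [], _ => 0
  | s :: l, 0 => if s = (0, 1) then columnUps l 0 + 1 else 0
  | s :: l, j + 1 => if s = (0, 1) then columnUps l (j + 1) else columnUps l j

/-- A list consists of unit steps right and up. -/
def IsLatticeWalk (l : List (ℤ × ℤ)) : Prop :=
  ∀ s ∈ l, s = ((1 : ℤ), (0 : ℤ)) ∨ s = ((0 : ℤ), (1 : ℤ))

theorem isLatticeWalk_cons {s : ℤ × ℤ} {l : List (ℤ × ℤ)} :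
    IsLatticeWalk (s :: l) ↔ (s = (1, 0) ∨ s = (0, 1)) ∧ IsLatticeWalk l := by
  simp only [IsLatticeWalk, List.forall_mem_cons]

theorem IsLatticeWalk.sum_fst_nonneg {l : List (ℤ × ℤ)} (hl : IsLatticeWalk l) :
    0 ≤ l.sum.1 := by
  induction l with
  | nil => simp
  | cons s l ih =>
    obtain ⟨rfl | rfl, h⟩ := isLatticeWalk_cons.1 hl <;> have := ih h <;> simp <;> omega

theorem columnUps_up (l : List (ℤ × ℤ)) (j : ℕ) :
    columnUps ((0, 1) :: l) j = columnUps l j + if j = 0 then 1 else 0 := by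
  cases j <;> simp [columnUps]

@[simp]
theorem columnUps_right_zero (l : List (ℤ × ℤ)) : columnUps ((1, 0) :: l) 0 = 0 := by
  simp [columnUps]

@[simp]
theorem columnUps_right_succ (l : List (ℤ × ℤ)) (j : ℕ) :
    columnUps ((1, 0) :: l) (j + 1) = columnUps l j := by
  simp [columnUps]

theorem card_filter_range_succ (p : ℕ → Prop) [DecidablePred p] (n : ℕ) :
    ((Finset.range (n + 1)).filter p).card =
      ((Finset.range n).filter fun t => p (t + 1)).card + if p 0 then 1 else 0 := by
  simp only [Finset.card_filter]
  rw [Finset.sum_range_succ']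

theorem IsLatticeWalk.card_filter_eq_zero {l : List (ℤ × ℤ)} (hl : IsLatticeWalk l) {x : ℤ}
    (hx : x < 0) :
    ((Finset.range l.length).filter fun t =>
      l.getD t (0, 0) = ((0 : ℤ), (1 : ℤ)) ∧
        ((l.take t).map Prod.fst).sum = x).card = 0 := by
  rw [Finset.card_eq_zero, Finset.filter_eq_empty_iff]
  rintro t - ⟨-, h⟩
  have : 0 ≤ ((l.take t).map Prod.fst).sum := by
    refine List.sum_nonneg fun y hy => ?_
    obtain ⟨s, hs, rfl⟩ := List.mem_map.1 hy
    rcases hl s (List.mem_of_mem_take hs) with rfl | rfl <;> simp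
  omega

theorem IsLatticeWalk.card_filter_eq_columnUps {l : List (ℤ × ℤ)} (hl : IsLatticeWalk l) (j : ℕ) :
    ((Finset.range l.length).filter fun t =>
      l.getD t (0, 0) = ((0 : ℤ), (1 : ℤ)) ∧
        ((l.take t).map Prod.fst).sum = (j : ℤ)).card = columnUps l j := by
  induction l generalizing j with
  | nil => simp [columnUps]
  | cons s l ih =>
    obtain ⟨rfl | rfl, h⟩ := isLatticeWalk_cons.1 hl
    · rw [List.length_cons, card_filter_range_succ, if_neg (by simp)]
      simp only [List.getD_cons_succ, List.take_succ_cons, List.map_cons, List.sum_cons,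
        ← eq_sub_iff_add_eq', add_zero]
      cases j with
      | zero => rw [columnUps_right_zero, h.card_filter_eq_zero (by norm_num)]
      | succ j =>
        rw [columnUps_right_succ, ← ih h, Nat.cast_succ, add_sub_cancel_right]
    · rw [List.length_cons, card_filter_range_succ, columnUps_up, ← ih h]
      simp only [List.getD_cons_succ, List.take_succ_cons, List.map_cons, List.sum_cons, zero_add]
      simp [eq_comm]

theorem IsLatticeWalk.columnUps_injective {l l' : List (ℤ × ℤ)} (hl : IsLatticeWalk l)
    (hl' : IsLatticeWalk l') (hsum : l.sum.1 = l'.sum.1) (h : columnUps l = columnUps l') :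
    l = l' := by
  induction l generalizing l' with
  | nil =>
    cases l' with
    | nil => rfl
    | cons s l' =>
      obtain ⟨rfl | rfl, htail'⟩ := isLatticeWalk_cons.1 hl'
      · have := htail'.sum_fst_nonneg
        simp only [List.sum_cons, List.sum_nil, Prod.fst_add, Prod.fst_zero] at hsum
        omega
      · have := congrFun h 0
        simp [columnUps] at this
  | cons s l ih =>
    obtain ⟨hs, htail⟩ := isLatticeWalk_cons.1 hl
    cases l' with
    | nil =>
      rcases hs with rfl | rfl
      · have := htail.sum_fst_nonneg
        simp only [List.sum_cons, List.sum_nil, Prod.fst_add, Prod.fst_zero] at hsum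
        omega
      · have := congrFun h 0
        simp [columnUps] at this
    | cons s' l' =>
      obtain ⟨hs', htail'⟩ := isLatticeWalk_cons.1 hl'
      rcases hs with rfl | rfl <;> rcases hs' with rfl | rfl
      · congr 1
        refine ih htail htail' (by simpa using hsum) (funext fun j => ?_)
        simpa using congrFun h (j + 1)
      · have := congrFun h 0
        simp [columnUps] at this
      · have := congrFun h 0
        simp [columnUps] at this
      · congr 1
        refine ih htail htail' (by simpa using hsum) (funext fun j => ?_)
        simpa [columnUps_up] using congrFun h j

theorem IsLatticeWalk.columnUps_eq_zero {l : List (ℤ × ℤ)} (hl : IsLatticeWalk l) {a j : ℕ}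
    (ha : l.sum.1 = a) (hj : a < j) : columnUps l j = 0 := by
  induction l generalizing a j with
  | nil => rfl
  | cons s l ih =>
    obtain ⟨rfl | rfl, h⟩ := isLatticeWalk_cons.1 hl
    · have := h.sum_fst_nonneg
      simp at ha
      obtain ⟨j, rfl⟩ : ∃ k, j = k + 1 := ⟨j - 1, by omega⟩
      rw [columnUps_right_succ]
      exact ih h (a := a - 1) (by omega) (by omega)
    · rw [columnUps_up, ih h (by simpa using ha) hj, if_neg (by omega)]

theorem IsLatticeWalk.sum_columnUps {l : List (ℤ × ℤ)} (hl : IsLatticeWalk l) {a : ℕ}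
    (ha : l.sum.1 = a) : ((∑ j ∈ Finset.range (a + 1), columnUps l j : ℕ) : ℤ) = l.sum.2 := by
  induction l generalizing a with
  | nil => simp [columnUps]
  | cons s l ih =>
    obtain ⟨rfl | rfl, h⟩ := isLatticeWalk_cons.1 hl
    · have := h.sum_fst_nonneg
      simp at ha
      obtain ⟨a, rfl⟩ : ∃ k, a = k + 1 := ⟨a - 1, by omega⟩
      rw [Finset.sum_range_succ']
      simp only [columnUps_right_succ, columnUps_right_zero, add_zero]
      rw [ih h (by push_cast at ha; omega)]
      simp
    · simp only [columnUps_up, Finset.sum_add_distrib]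
      push_cast
      rw [← Nat.cast_sum, ih h (by simpa using ha)]
      simp [add_comm]

theorem columnUps_replicate_append (u : ℕ) (l : List (ℤ × ℤ)) (j : ℕ) :
    columnUps (List.replicate u (0, 1) ++ l) j = columnUps l j + if j = 0 then u else 0 := by
  induction u with
  | zero => simp
  | succ u ih =>
    rw [List.replicate_succ, List.cons_append, columnUps_up, ih]
    split_ifs <;> rfl

theorem IsLatticeWalk.replicate_append {l : List (ℤ × ℤ)} (hl : IsLatticeWalk l) (u : ℕ) :
    IsLatticeWalk (List.replicate u (0, 1) ++ l) := by
  intro s hs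
  rcases List.mem_append.1 hs with h | h
  · exact Or.inr (List.eq_of_mem_replicate h)
  · exact hl s h

theorem exists_isLatticeWalk_columnUps (a : ℕ) (f : ℕ → ℕ) (hf : ∀ j, a < j → f j = 0) :
    ∃ l, IsLatticeWalk l ∧ l.sum.1 = a ∧ columnUps l = f := by
  induction a generalizing f with
  | zero =>
    have hnil : IsLatticeWalk [] := by simp [IsLatticeWalk]
    refine ⟨List.replicate (f 0) (0, 1) ++ [], hnil.replicate_append _, by simp, ?_⟩
    ext j
    rw [columnUps_replicate_append]
    rcases j with _ | j
    · simp [columnUps]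
    · simp [columnUps, hf (j + 1)]
  | succ a ih =>
    obtain ⟨l, hl, hsum, hups⟩ := ih (fun j => f (j + 1)) fun j hj => hf _ (by omega)
    have hright : IsLatticeWalk ((1, 0) :: l) := isLatticeWalk_cons.2 ⟨Or.inl rfl, hl⟩
    refine ⟨List.replicate (f 0) (0, 1) ++ (1, 0) :: l, hright.replicate_append _, ?_, ?_⟩
    · simp [hsum, add_comm]
    · ext j
      rw [columnUps_replicate_append]
      cases j <;> simp [hups]

theorem card_latticeWalks_eq_card_antidiag (a b n m : ℕ) (hm : 0 < m) :
    Nat.card {l : List (ℤ × ℤ) // IsLatticeWalk l ∧ l.sum = ((a : ℤ), (b : ℤ)) ∧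
        ∀ j < n, columnUps l j < m} =
      ((Finset.finsuppAntidiag (Finset.range (a + 1)) b).filter
        fun f => ∀ j ∈ Finset.range (a + 1), j < n → f j < m).card := by
  rw [← Nat.card_eq_finsetCard]
  have hsupp {l : List (ℤ × ℤ)} (hl : IsLatticeWalk l) (hsum : l.sum = ((a : ℤ), (b : ℤ))) (j : ℕ)
      (hj : columnUps l j ≠ 0) : j ∈ Finset.range (a + 1) := by
    contrapose! hj
    exact hl.columnUps_eq_zero (congrArg Prod.fst hsum) (by
      rw [Finset.mem_range] at hj
      omega)
  refine Nat.card_congr (Equiv.ofBijective (fun l =>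
    ⟨Finsupp.onFinset (Finset.range (a + 1)) (columnUps l.1) (hsupp l.2.1 l.2.2.1), ?_⟩) ⟨?_, ?_⟩)
  · obtain ⟨l, hl, hsum, hlt⟩ := l
    rw [Finset.mem_filter, Finset.mem_finsuppAntidiag]
    refine ⟨⟨?_, Finsupp.support_onFinset_subset⟩, fun j _ hj => hlt j hj⟩
    have := hl.sum_columnUps (congrArg Prod.fst hsum)
    rw [hsum] at this
    exact Nat.cast_injective this
  · rintro ⟨l, hl, hsum, _⟩ ⟨l', hl', hsum', _⟩ heq
    have hfun := congrArg Subtype.val heq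
    refine Subtype.ext (hl.columnUps_injective hl' (by rw [hsum, hsum']) (funext fun j => ?_))
    exact DFunLike.congr_fun hfun j
  · rintro ⟨f, hf⟩
    obtain ⟨hf, hlt⟩ := Finset.mem_filter.1 hf
    obtain ⟨hsum, hsub⟩ := Finset.mem_finsuppAntidiag.1 hf
    have hzero (j : ℕ) (hj : a < j) : f j = 0 := by
      by_contra h
      have := Finset.mem_range.1 (hsub (Finsupp.mem_support_iff.2 h))
      omega
    obtain ⟨l, hl, hla, hups⟩ := exists_isLatticeWalk_columnUps a f hzero
    refine ⟨⟨l, hl, Prod.ext hla ?_, fun j hj => ?_⟩, Subtype.ext (Finsupp.ext (congrFun hups))⟩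
    · rw [← hl.sum_columnUps hla, hups, hsum]
    · rw [hups]
      rcases lt_or_ge a j with h | h
      · rwa [hzero j h]
      · exact hlt j (Finset.mem_range.2 (by omega)) hj

open PowerSeries in
theorem card_antidiag_eq_coeff (a b n m : ℕ) :
    (((Finset.finsuppAntidiag (Finset.range (a + 1)) b).filter
        fun f => ∀ j ∈ Finset.range (a + 1), j < n → f j < m).card : ℤ) =
      coeff b (∏ j ∈ Finset.range (a + 1),
        if j < n then ∑ k ∈ Finset.range m, (X : ℤ⟦X⟧) ^ k else mk 1) := by
  rw [coeff_prod, Finset.card_filter, Nat.cast_sum]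
  refine Finset.sum_congr rfl fun f _ => ?_
  rw [Nat.cast_ite, Nat.cast_one, Nat.cast_zero, ← Finset.prod_boole]
  refine Finset.prod_congr rfl fun j _ => ?_
  by_cases hj : j < n
  · simp [hj, coeff_X_pow]
  · simp [hj]

theorem prod_range_ite_lt {M : Type*} [CommMonoid M] (c n : ℕ) (x y : M) :
    (∏ j ∈ Finset.range c, if j < n then x else y) = x ^ min n c * y ^ (c - n) := by
  induction c with
  | zero => simp
  | succ c ih =>
    rw [Finset.prod_range_succ, ih]
    split_ifs with h
    · rw [min_eq_right h.le, min_eq_right (by omega), Nat.sub_eq_zero_of_le h.le,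
        Nat.sub_eq_zero_of_le (by omega), pow_succ]
      simp
    · rw [min_eq_left (by omega), min_eq_left (by omega), Nat.succ_sub (by omega), pow_succ,
        mul_assoc]

open PowerSeries in
theorem geom_sum_eq_one_sub_X_pow_mul (m : ℕ) :
    ∑ k ∈ Finset.range m, (X : ℤ⟦X⟧) ^ k = (1 - X ^ m) * mk 1 := by
  have h1 := geom_sum_mul_neg (X : ℤ⟦X⟧) m
  have h2 := mk_one_mul_one_sub_eq_one ℤ
  linear_combination (mk 1) * h1 - (∑ k ∈ Finset.range m, (X : ℤ⟦X⟧) ^ k) * h2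

open PowerSeries in
theorem coeff_eq_zero_of_le {c e m N : ℕ} (hm : 0 < m) (hc : 0 < c) (h : m * (e + c) ≤ N) :
    coeff (N) ((1 - (X : ℤ⟦X⟧) ^ m) ^ e * (∑ k ∈ Finset.range m, (X : ℤ⟦X⟧) ^ k) ^ c)
      = 0 := by
  set p : Polynomial ℤ := (1 - Polynomial.X ^ m) ^ e *
    (∑ k ∈ Finset.range m, Polynomial.X ^ k) ^ c with hp
  have hcoe : (p : ℤ⟦X⟧) = (1 - (X : ℤ⟦X⟧) ^ m) ^ e *
      (∑ k ∈ Finset.range m, (X : ℤ⟦X⟧) ^ k) ^ c := by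
    have : ((∑ k ∈ Finset.range m, Polynomial.X ^ k : Polynomial ℤ) : ℤ⟦X⟧) =
        ∑ k ∈ Finset.range m, (X : ℤ⟦X⟧) ^ k := by
      rw [← Polynomial.coeToPowerSeries.ringHom_apply, map_sum]
      simp
    rw [hp, Polynomial.coe_mul, Polynomial.coe_pow, Polynomial.coe_pow, this]
    simp
  rw [← hcoe, Polynomial.coeff_coe]
  refine Polynomial.coeff_eq_zero_of_natDegree_lt ?_
  have h1 : (1 - Polynomial.X ^ m : Polynomial ℤ).natDegree ≤ m := by
    compute_degree
  have h2 : (∑ k ∈ Finset.range m, Polynomial.X ^ k : Polynomial ℤ).natDegree ≤ m - 1 := by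
    refine Polynomial.natDegree_sum_le_of_forall_le _ _ fun k hk => ?_
    rw [Polynomial.natDegree_X_pow]
    have := Finset.mem_range.1 hk
    omega
  have h3 : p.natDegree ≤ e * m + c * (m - 1) :=
    Polynomial.natDegree_mul_le_of_le (Polynomial.natDegree_pow_le_of_le _ h1)
      (Polynomial.natDegree_pow_le_of_le _ h2)
  refine h3.trans_lt ?_
  obtain ⟨m, rfl⟩ := Nat.exists_eq_succ_of_ne_zero hm.ne'
  simp only [Nat.succ_eq_add_one, Nat.add_sub_cancel] at h ⊢
  nlinarith

open PowerSeries in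
theorem coeff_prod_eq_coeff {c n m : ℕ} (hm : 0 < m) (hc : 0 < c) :
    coeff (m * n) (∏ j ∈ Finset.range c,
        if j < n then ∑ k ∈ Finset.range m, (X : ℤ⟦X⟧) ^ k else mk 1) =
      coeff (m * n) ((1 - (X : ℤ⟦X⟧) ^ m) ^ n * mk 1 ^ c) := by
  rw [prod_range_ite_lt]
  rcases le_total n c with h | h
  · rw [min_eq_left h, geom_sum_eq_one_sub_X_pow_mul, mul_pow, mul_assoc, ← pow_add,
      Nat.add_sub_cancel' h]
  · have h0 := coeff_eq_zero_of_le (e := 0) (N := m * n) hm hc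
      (Nat.mul_le_mul_left m (by omega))
    have h1 := coeff_eq_zero_of_le (e := n - c) (N := m * n) hm hc
      (Nat.mul_le_mul_left m (by omega))
    rw [geom_sum_eq_one_sub_X_pow_mul, mul_pow, ← mul_assoc, ← pow_add, Nat.sub_add_cancel h] at h1
    rw [h1, min_eq_right h, Nat.sub_eq_zero_of_le h, pow_zero, mul_one]
    simpa using h0

open PowerSeries in
theorem coeff_one_sub_X_pow_mul (m n c : ℕ) :
    coeff (m * n) ((1 - (X : ℤ⟦X⟧) ^ m) ^ n * mk 1 ^ (c + 1)) =
      (-1) ^ n * ∑ k ∈ Finset.range (n + 1), (n.choose k : ℤ) * (-1) ^ k *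
        ((m * k + c).choose c : ℤ) := by
  rw [sub_eq_add_neg, add_comm, add_pow, Finset.sum_mul, map_sum,
    mk_one_pow_eq_mk_choose_add, ← Finset.sum_range_reflect, Finset.mul_sum]
  refine Finset.sum_congr rfl fun k hk => ?_
  have hk : k ≤ n := Nat.lt_succ_iff.1 (Finset.mem_range.1 hk)
  obtain ⟨e, rfl⟩ := Nat.exists_eq_add_of_le hk
  have hsub : k + e + 1 - 1 - k = e := by omega
  rw [hsub, neg_pow, ← pow_mul, one_pow, mul_one]
  have hrw : (-1 : ℤ⟦X⟧) ^ e * X ^ (m * e) * ((k + e).choose e : ℤ⟦X⟧) *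
      mk (fun n => ((c + n).choose c : ℤ)) =
      C ((-1 : ℤ) ^ e * ((k + e).choose e : ℤ)) *
        (mk (fun n => ((c + n).choose c : ℤ)) * X ^ (m * e)) := by
    simp only [map_mul, map_pow, map_neg, map_one, map_natCast]
    ring
  rw [hrw, coeff_C_mul, mul_add, coeff_mul_X_pow, coeff_mk, ← Nat.choose_symm_add, add_comm c]
  have hsq : (-1 : ℤ) ^ k * (-1) ^ k = 1 := by rw [← mul_pow]; simp
  rw [pow_add]
  linear_combination (-(-1) ^ e * ((k + e).choose k : ℤ) * ((m * k + c).choose c : ℤ)) * hsq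


/-- **Corollary (lattice path interpretation).** For even `d ≥ 2` and `i ≥ 1`,
`(-1)^(i-1) · Σ_{k=0}^{i-1} C(i-1,k) (-1)^k C(d/2·(k+1)+1, d/2+1)` equals the number of
lattice walks from `(0,0)` to `(d/2+1, d(i-1)/2)` using unit steps right `(1,0)` and up
`(0,1)` such that for each `j` with `0 ≤ j ≤ i-2` the number of up steps taken at
`x`-coordinate `j` is strictly less than `d/2`.  A walk is a finite sequence (list) of
steps, each `(1,0)` or `(0,1)`, summing to the endpoint; the `x`-coordinate of the step
at position `t` is the sum of the first coordinates of the earlier steps. -/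
theorem signed_sum_counts_lattice_walks (d i : ℕ) (hd : 2 ≤ d) (hde : Even d)
    (hi : 1 ≤ i) :
    (-1 : ℤ) ^ (i - 1) *
        ∑ k ∈ Finset.range i, ((i - 1).choose k : ℤ) * (-1) ^ k *
          ((d / 2 * (k + 1) + 1).choose (d / 2 + 1) : ℤ) =
      (Nat.card {l : List (ℤ × ℤ) //
        (∀ st ∈ l, st = ((1 : ℤ), (0 : ℤ)) ∨ st = ((0 : ℤ), (1 : ℤ))) ∧
        l.sum = (((d / 2 + 1 : ℕ) : ℤ), ((d * (i - 1) / 2 : ℕ) : ℤ)) ∧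
        ∀ j : ℕ, j + 2 ≤ i →
          ((Finset.range l.length).filter fun t =>
            l.getD t (0, 0) = ((0 : ℤ), (1 : ℤ)) ∧
              ((l.take t).map Prod.fst).sum = (j : ℤ)).card < d / 2} : ℤ) := by
  obtain ⟨m, rfl⟩ := hde
  obtain ⟨n, rfl⟩ := Nat.exists_eq_add_of_le' hi
  have hm : (m + m) / 2 = m := by omega
  have hmn : (m + m) * n / 2 = m * n := by
    rw [← two_mul, mul_assoc, Nat.mul_div_cancel_left _ two_pos]
  simp only [Nat.add_sub_cancel, hm, hmn]
  have hcard := card_latticeWalks_eq_card_antidiag (m + 1) (m * n) n m (by omega)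
  have hcoeff := card_antidiag_eq_coeff (m + 1) (m * n) n m
  rw [coeff_prod_eq_coeff (by omega) (by omega), coeff_one_sub_X_pow_mul, ← hcard] at hcoeff
  have hequiv := Nat.card_congr (Equiv.subtypeEquivRight fun l : List (ℤ × ℤ) =>
    and_congr_right fun hl : IsLatticeWalk l =>
      and_congr_right fun _ : l.sum = (((m + 1 : ℕ) : ℤ), ((m * n : ℕ) : ℤ)) =>
        (forall_congr' fun j => by
          rw [hl.card_filter_eq_columnUps, Nat.add_le_add_iff_right (n := 1) (m := j + 1)]
          exact Iff.rfl :
        (∀ j : ℕ, j + 2 ≤ n + 1 →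
          ((Finset.range l.length).filter fun t =>
            l.getD t (0, 0) = ((0 : ℤ), (1 : ℤ)) ∧
              ((l.take t).map Prod.fst).sum = (j : ℤ)).card < m) ↔
          ∀ j < n, columnUps l j < m))
  refine Eq.trans ?_ (hcoeff.symm.trans (congrArg Nat.cast hequiv.symm))
  simp only [mul_add, mul_one, add_assoc]
end

section
/- For all even integers d ≥ 2 and all integers i ≥ 1, the integer (-1)^{i-1} · Σ_{k=0}^{i-1} binom(i-1, k) (-1)^k binom(d/2·(k+1)+1, d/2+1) is nonnegative; equivalently, for even d the coefficient C_i^{(d)} has sign (-1)^{i-1} (or is zero). -/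
/-- All iterated forward differences of `k ↦ C(mk + a, r)` are nonnegative. -/
lemma fwdDiff_iter_choose_mul_add_nonneg (m n r a y : ℕ) :
    0 ≤ ((fwdDiff 1)^[n] fun k : ℕ ↦ ((m * k + a).choose r : ℤ)) y := by
  induction n generalizing r a with
  | zero => simp
  | succ n ih =>
    rw [Function.iterate_succ_apply]
    cases r with
    | zero =>
      have h : (fwdDiff 1 fun k : ℕ ↦ ((m * k + a).choose 0 : ℤ)) = ∑ j ∈ (∅ : Finset ℕ),
          fun k : ℕ ↦ ((m * k + (a + j)).choose 0 : ℤ) := by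
        ext k
        simp [fwdDiff]
      rw [h, fwdDiff_iter_finsetSum]
      simp
    | succ r =>
      have h : (fwdDiff 1 fun k : ℕ ↦ ((m * k + a).choose (r + 1) : ℤ)) = ∑ j ∈ Finset.range m,
          fun k : ℕ ↦ ((m * k + (a + j)).choose r : ℤ) := by
        ext k
        have telescope := Finset.sum_range_sub
          (fun j ↦ ((m * k + (a + j)).choose (r + 1) : ℤ)) m
        rw [Finset.sum_apply, fwdDiff, show m * (k + 1) + a = m * k + (a + m) by ring]
        rw [add_zero] at telescope
        rw [← telescope]
        refine Finset.sum_congr rfl fun j _ ↦ ?_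
        rw [← add_assoc a, ← add_assoc, Nat.choose_succ_succ']
        push_cast
        ring
      rw [h, fwdDiff_iter_finsetSum, Finset.sum_apply]
      exact Finset.sum_nonneg fun j _ ↦ ih r (a + j)

/-- For even `d ≥ 2` and `i ≥ 1`, the integer
`(-1)^(i-1) · Σ_{k=0}^{i-1} C(i-1,k) (-1)^k C(d/2·(k+1)+1, d/2+1)` is nonnegative;
equivalently, for even `d` the causal set d'Alembertian coefficient `C_i^{(d)}` has
sign `(-1)^(i-1)` (or vanishes). -/
theorem signed_sum_nonneg_even (d i : ℕ) (hd : 2 ≤ d) (hde : Even d) (hi : 1 ≤ i) :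
    0 ≤ (-1 : ℤ) ^ (i - 1) *
        ∑ k ∈ Finset.range i, ((i - 1).choose k : ℤ) * (-1) ^ k *
          ((d / 2 * (k + 1) + 1).choose (d / 2 + 1) : ℤ) := by
  obtain ⟨n, rfl⟩ := Nat.exists_eq_add_of_le' hi
  convert fwdDiff_iter_choose_mul_add_nonneg (d / 2) n (d / 2 + 1) (d / 2 + 1) 0 using 1
  rw [fwdDiff_iter_eq_sum_shift, Nat.add_sub_cancel, Finset.mul_sum]
  refine Finset.sum_congr rfl fun k hk ↦ ?_
  obtain ⟨l, rfl⟩ := Nat.exists_eq_add_of_le (Finset.mem_range_succ_iff.mp hk)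
  rw [Nat.add_sub_cancel_left, zero_add, smul_eq_mul, smul_eq_mul, mul_one, mul_add_one,
    add_assoc (d / 2 * k), pow_add]
  linear_combination (-1 : ℤ) ^ l * ((k + l).choose k : ℤ) *
    ((d / 2 * k + (d / 2 + 1)).choose (d / 2 + 1) : ℤ) *
      pow_mul_pow_eq_one k (show (-1 : ℤ) * -1 = 1 by norm_num)
end

section
/- For all integers d ≥ 2 and i ≥ 1, the rational number (-1)^{i-1} · Σ_{k=0}^{i-1} binom(i-1,k) (-1)^k · P(d,k), where P(d,k) = (∏_{s=1}^{⌊d/2⌋+1} (2dk+4s)) / (⌊d/2⌋+1)!, is a nonnegative integer. -/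
open scoped fwdDiff Nat

/-- Multiplying by an affine function with nonnegative coefficients preserves nonnegativity of all
iterated forward differences. -/
lemma fwdDiff_iter_affine_mul_nonneg {a b : ℚ} (ha : 0 ≤ a) (hb : 0 ≤ b) (m : ℕ) {f : ℕ → ℚ}
    (hf : ∀ m x, 0 ≤ (Δ_[1])^[m] f x) (x : ℕ) :
    0 ≤ (Δ_[1])^[m] (fun k : ℕ ↦ (a * k + b) * f k) x := by
  induction m generalizing f with
  | zero => exact mul_nonneg (by positivity) (hf 0 x)
  | succ m ih =>
    have leibniz : Δ_[1] (fun k : ℕ ↦ (a * k + b) * f k) =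
        (fun k : ℕ ↦ (a * k + b) * Δ_[1] f k) + a • fun k ↦ f (k + 1) := by
      ext k
      simp only [fwdDiff, Pi.add_apply, Pi.smul_apply, smul_eq_mul]
      push_cast
      ring
    rw [Function.iterate_succ_apply, leibniz, fwdDiff_iter_add, fwdDiff_iter_const_smul,
      Pi.add_apply, Pi.smul_apply, fwdDiff_iter_comp_add]
    exact add_nonneg (ih fun m x ↦ by simpa using hf (m + 1) x)
      (mul_nonneg ha (hf m (x + 1)))

/-- A product of affine functions with nonnegative coefficients has nonnegative iterated forward
differences. -/
lemma fwdDiff_iter_prod_affine_nonneg {ι : Type*} (s : Finset ι) {a b : ι → ℚ}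
    (ha : ∀ i, 0 ≤ a i) (hb : ∀ i, 0 ≤ b i) (m x : ℕ) :
    0 ≤ (Δ_[1])^[m] (fun k : ℕ ↦ ∏ i ∈ s, (a i * k + b i)) x := by
  classical
  induction s using Finset.induction_on generalizing m x with
  | empty =>
    cases m with
    | zero => simp
    | succ m =>
      have hzero : (Δ_[1])^[m] (0 : ℕ → ℚ) = 0 := by
        simpa using fwdDiff_iter_const_smul (1 : ℕ) (0 : ℕ) (0 : ℕ → ℚ) m
      simp only [Finset.prod_empty, Function.iterate_succ_apply, fwdDiff_const]
      exact (congrFun hzero x).ge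
  | insert i s hi ih =>
    simp only [Finset.prod_insert hi]
    exact fwdDiff_iter_affine_mul_nonneg (ha i) (hb i) m ih x

lemma two_pow_mul_prod_odd (n : ℕ) :
    2 ^ n * ∏ s ∈ Finset.range n, (1 + 2 * (s + 1)) = n ! * ((2 * n + 1) * n.centralBinom) := by
  induction n with
  | zero => simp
  | succ n ih =>
    rw [Finset.prod_range_succ, Nat.factorial_succ]
    linear_combination 2 * (2 * n + 3) * ih - n ! * (2 * n + 3) * n.succ_mul_centralBinom_succ

lemma factorial_dvd_two_pow_mul_prod (a n : ℕ) :
    n ! ∣ 2 ^ n * ∏ s ∈ Finset.range n, (a + 2 * (s + 1)) := by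
  induction a using Nat.twoStepInduction generalizing n with
  | zero =>
    simp only [zero_add, Finset.prod_mul_distrib, Finset.prod_range_add_one_eq_factorial]
    exact ((dvd_refl _).mul_left _).mul_left _
  | one => exact ⟨_, two_pow_mul_prod_odd n⟩
  | more a ih _ =>
    induction n with
    | zero => simp
    | succ n ihn =>
      have split : 2 ^ (n + 1) * ∏ s ∈ Finset.range (n + 1), (a + 2 + 2 * (s + 1)) =
          2 ^ (n + 1) * ∏ s ∈ Finset.range (n + 1), (a + 2 * (s + 1)) +
            4 * ((n + 1) * (2 ^ n * ∏ s ∈ Finset.range n, (a + 2 + 2 * (s + 1)))) := by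
        have shift : ∏ s ∈ Finset.range n, (a + 2 * (s + 1 + 1)) =
            ∏ s ∈ Finset.range n, (a + 2 + 2 * (s + 1)) :=
          Finset.prod_congr rfl fun s _ ↦ by ring
        rw [Finset.prod_range_succ, Finset.prod_range_succ' (fun s ↦ a + 2 * (s + 1)), shift]
        ring
      rw [split]
      refine dvd_add (ih (n + 1)) (Dvd.dvd.mul_left ?_ 4)
      rw [Nat.factorial_succ]
      exact mul_dvd_mul_left _ ihn

lemma exists_nat_eq_prod_div_factorial (d k n : ℕ) :
    ∃ N : ℕ, (∏ s ∈ Finset.Icc 1 n, (2 * (d : ℚ) * k + 4 * s)) / (n ! : ℚ) = N := by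
  obtain ⟨N, hN⟩ := factorial_dvd_two_pow_mul_prod (d * k) n
  refine ⟨N, ?_⟩
  rw [div_eq_iff (by positivity), mul_comm (N : ℚ), ← Nat.cast_mul, ← hN,
    ← Finset.Ico_add_one_right_eq_Icc,
    Finset.prod_Ico_eq_prod_range]
  push_cast
  rw [← Finset.card_range n, ← Finset.prod_const, Finset.card_range, ← Finset.prod_mul_distrib]
  exact Finset.prod_congr rfl fun s _ ↦ by ring

/-- For all `d ≥ 2` and `i ≥ 1`, the rational number
`(-1)^(i-1) · Σ_{k=0}^{i-1} C(i-1,k) (-1)^k · P(d,k)`, where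
`P(d,k) = (∏_{s=1}^{⌊d/2⌋+1} (2dk+4s)) / (⌊d/2⌋+1)!`, is a nonnegative integer
(it equals `(-1)^(i-1) · 2^(2⌊d/2⌋+2) · C_i^{(d)}`). -/
theorem signed_scaled_coefficient_is_nat (d i : ℕ) (hd : 2 ≤ d) (hi : 1 ≤ i) :
    ∃ N : ℕ,
      (-1 : ℚ) ^ (i - 1) *
          ∑ k ∈ Finset.range i, ((i - 1).choose k : ℚ) * (-1) ^ k *
            ((∏ s ∈ Finset.Icc 1 (d / 2 + 1), (2 * (d : ℚ) * k + 4 * s)) /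
              (Nat.factorial (d / 2 + 1) : ℚ)) = (N : ℚ) := by
  obtain ⟨m, rfl⟩ := Nat.exists_eq_add_of_le' hi
  rw [Nat.add_sub_cancel]
  set n := d / 2 + 1
  have nonneg : 0 ≤ (-1 : ℚ) ^ m * ∑ k ∈ Finset.range (m + 1), (m.choose k : ℚ) * (-1) ^ k *
      ((∏ s ∈ Finset.Icc 1 n, (2 * (d : ℚ) * k + 4 * s)) / (n ! : ℚ)) := by
    have h := fwdDiff_iter_prod_affine_nonneg (Finset.Icc 1 n) (a := fun _ ↦ 2 * (d : ℚ))
      (b := fun s ↦ 4 * (s : ℚ)) (fun _ ↦ by positivity) (fun _ ↦ by positivity) m 0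
    refine (div_nonneg h (by positivity : (0 : ℚ) ≤ n !)).trans_eq (Eq.symm ?_)
    rw [fwdDiff_iter_eq_sum_shift, Finset.mul_sum, Finset.sum_div]
    refine Finset.sum_congr rfl fun k hk ↦ ?_
    obtain ⟨j, rfl⟩ := Nat.exists_eq_add_of_le (Finset.mem_range_succ_iff.mp hk)
    have sign : (-1 : ℚ) ^ (k + j) * (-1) ^ k = (-1) ^ j := by
      rw [pow_add, mul_right_comm, ← mul_pow]
      simp
    rw [Nat.add_sub_cancel_left, zsmul_eq_mul]
    simp only [zero_add, smul_eq_mul, mul_one]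
    push_cast
    rw [← sign]
    ring
  choose P hP using fun k ↦ exists_nat_eq_prod_div_factorial d k n
  simp only [hP] at nonneg ⊢
  have integral : (-1 : ℚ) ^ m * ∑ k ∈ Finset.range (m + 1), (m.choose k : ℚ) * (-1) ^ k * P k =
      (((-1) ^ m * ∑ k ∈ Finset.range (m + 1), (m.choose k : ℤ) * (-1) ^ k * P k : ℤ) : ℚ) := by
    push_cast
    rfl
  rw [integral] at nonneg ⊢
  obtain ⟨N, hN⟩ := Int.eq_ofNat_of_zero_le (Int.cast_nonneg_iff.mp nonneg)
  exact ⟨N, by rw [hN, Int.cast_natCast]⟩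
end
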